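/- arXiv:1001.1980 — 3 statements merged into one kernel-verified Lean document; each statement's English description precedes it below -/
import Mathlib

section
/- There exists an absolute constant C such that the following holds. Let p be a prime, and let P be a set of points and L a set of lines in the projective plane ℙ²(𝔽_p) with |P| = |L| = n < p. Then the number of incidences I(P, L) = |{(q, ℓ) ∈ P × L : q ∈ ℓ}| satisfies I(P, L) ≤ C · n^(3/2 − 1/10678). -/
section Helpers
open Finset Pointwise

theorem popular {ι : Type*} (s : Finset ι) (f : ι → ℝ) (c U : ℝ) (hU : ∀ i ∈ s, f i ≤ U) :
    ∑ i ∈ s, f i ≤ #{i ∈ s | c ≤ f i} * U + #{i ∈ s | ¬ c ≤ f i} * c := by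
  rw [← Finset.sum_filter_add_sum_filter_not s (fun i => c ≤ f i)]
  gcongr
  · rw [← nsmul_eq_mul]
    exact Finset.sum_le_card_nsmul _ _ _ fun i hi => hU i (mem_filter.1 hi).1
  · rw [← nsmul_eq_mul]
    exact Finset.sum_le_card_nsmul _ _ _ fun i hi => (not_le.1 (mem_filter.1 hi).2).le

theorem popular' {ι : Type*} (s : Finset ι) (f : ι → ℝ) (c U m : ℝ) (hU : ∀ i ∈ s, f i ≤ U)
    (hc : 0 ≤ c) (hm : #s ≤ m) :
    ∑ i ∈ s, f i ≤ #{i ∈ s | c ≤ f i} * U + m * c := by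
  refine (popular s f c U hU).trans ?_
  gcongr
  refine le_trans ?_ hm
  exact_mod_cast card_le_card (filter_subset _ _)

theorem popular_rich {ι : Type*} (s : Finset ι) (f : ι → ℝ) (c m : ℝ)
    (hc : 0 ≤ c) (hm : #s ≤ m) :
    ∑ i ∈ s, f i ≤ ∑ i ∈ s with c ≤ f i, f i + m * c := by
  rw [← Finset.sum_filter_add_sum_filter_not s (fun i => c ≤ f i)]
  gcongr
  refine le_trans (Finset.sum_le_card_nsmul _ _ c
    fun i hi => (not_le.1 (mem_filter.1 hi).2).le) ?_
  rw [nsmul_eq_mul]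
  gcongr
  refine le_trans ?_ hm
  exact_mod_cast card_le_card (filter_subset _ _)

theorem dcount {ι κ : Type*} (s : Finset ι) (t : Finset κ) (r : ι → κ → Prop)
    [∀ a b, Decidable (r a b)] :
    ∑ a ∈ s, (#{b ∈ t | r a b} : ℝ) = ∑ b ∈ t, (#{a ∈ s | r a b} : ℝ) := by
  exact_mod_cast Finset.sum_card_bipartiteAbove_eq_sum_card_bipartiteBelow r

theorem card_le_of {ι : Type*} {s t : Finset ι} {m : ℝ} (h : s ⊆ t) (ht : (#t : ℝ) ≤ m) :
    (#s : ℝ) ≤ m := le_trans (by exact_mod_cast card_le_card h) ht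

set_option maxHeartbeats 1000000 in
theorem bsg {G : Type*} [AddCommGroup G] [DecidableEq G] (A B S : Finset G)
    (E : Finset (G × G)) (hE : E ⊆ A ×ˢ B) (m α : ℝ) (hm : 0 < m) (hα : 0 < α)
    (hA : #A ≤ m) (hB : #B ≤ m) (hEc : α * m ^ 2 ≤ #E)
    (hS : ∀ e ∈ E, e.1 + e.2 ∈ S) (hSm : #S ≤ m) :
    ∃ A' ⊆ A, ∃ B' ⊆ B, α / 16 * m ≤ #A' ∧ α / 16 * m ≤ #B' ∧
      (α / 16) ^ 5 * #(A' + B') ≤ m := by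
  classical
  have hBne : B.Nonempty := by
    rw [nonempty_iff_ne_empty]; rintro rfl
    have : E = ∅ := by simpa using hE
    rw [this] at hEc; simp at hEc; nlinarith [mul_pos hα (pow_pos hm 2)]
  set deg : G → ℝ := fun a => (#{b ∈ B | (a, b) ∈ E} : ℝ) with hdeg
  have hsumdeg : ∑ a ∈ A, deg a = #E := by
    have : #E = ∑ a ∈ A, #{e ∈ E | e.1 = a} :=
      card_eq_sum_card_fiberwise fun e he => (mem_product.1 (hE he)).1
    rw [this]; push_cast
    refine sum_congr rfl fun a ha => ?_
    simp only [hdeg]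
    congr 1
    refine card_bij (fun b _ => (a, b)) ?_ ?_ ?_
    · intro b hb; simp at hb ⊢; exact hb.2
    · intro b _ b' _ h; simpa using h
    · rintro ⟨a', b⟩ hb
      simp only [mem_filter] at hb
      obtain ⟨hb, rfl⟩ := hb
      exact ⟨b, by simp [hb, (mem_product.1 (hE hb)).2], rfl⟩
  set A0 := {a ∈ A | α * m / 2 ≤ deg a} with hA0
  have hA0s : A0 ⊆ A := filter_subset _ _
  have h1 : α * m ^ 2 / 2 ≤ ∑ a ∈ A0, deg a := by
    have := popular_rich A deg (α * m / 2) m (by positivity) hA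
    rw [hsumdeg] at this
    nlinarith
  set N : G → Finset G := fun b => {a ∈ A0 | (a, b) ∈ E} with hN
  have h2 : ∑ b ∈ B, (#(N b) : ℝ) = ∑ a ∈ A0, deg a :=
    (dcount A0 B (fun a b => (a, b) ∈ E)).symm
  clear_value deg N
  have h3 : α ^ 2 * m ^ 3 / 4 ≤ ∑ b ∈ B, (#(N b) : ℝ) ^ 2 := by
    have h := sq_sum_le_card_mul_sum_sq (s := B) (f := fun b => (#(N b) : ℝ))
    rw [h2] at h
    have h0 : 0 ≤ ∑ b ∈ B, (#(N b) : ℝ) ^ 2 := sum_nonneg fun _ _ => sq_nonneg _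
    have h4 : (α * m ^ 2 / 2) ^ 2 ≤ m * ∑ b ∈ B, (#(N b) : ℝ) ^ 2 := by
      refine (pow_le_pow_left₀ (by positivity) h1 2).trans (h.trans ?_)
      exact mul_le_mul_of_nonneg_right hB h0
    have : m * (α ^ 2 * m ^ 3 / 4) ≤ m * ∑ b ∈ B, (#(N b) : ℝ) ^ 2 := by
      refine le_trans (le_of_eq ?_) h4; ring
    exact le_of_mul_le_mul_left this hm
  set codeg : G × G → ℝ := fun x => (#{b ∈ B | (x.1, b) ∈ E ∧ (x.2, b) ∈ E} : ℝ) with hcodeg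
  set Bd := {x ∈ A0 ×ˢ A0 | codeg x < α ^ 3 / 128 * m} with hBd
  set bad : G → ℝ := fun b => (#{x ∈ Bd | (x.1, b) ∈ E ∧ (x.2, b) ∈ E} : ℝ) with hbad
  have hbadnn : ∀ b, 0 ≤ bad b := fun b => by simp [hbad]
  have hA0m : (#A0 : ℝ) ≤ m := card_le_of hA0s hA
  have h5 : ∑ b ∈ B, bad b ≤ α ^ 3 / 128 * m * m ^ 2 := by
    rw [hbad, ← dcount Bd B (fun x b => (x.1, b) ∈ E ∧ (x.2, b) ∈ E)]
    refine (Finset.sum_le_card_nsmul _ _ (α ^ 3 / 128 * m) fun x hx =>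
      (mem_filter.1 hx).2.le).trans ?_
    rw [nsmul_eq_mul, mul_comm]
    gcongr
    refine card_le_of (filter_subset _ _) ?_
    rw [card_product, sq]; push_cast; gcongr
  clear_value bad codeg
  obtain ⟨b0, hb0, hb0'⟩ : ∃ b ∈ B, α ^ 2 * m ^ 2 / 8 ≤ (#(N b) : ℝ) ^ 2 - 16 / α * bad b := by
    refine exists_le_of_sum_le hBne ?_
    rw [sum_const, sum_sub_distrib, ← mul_sum, nsmul_eq_mul]
    have e1 : (#B : ℝ) * (α ^ 2 * m ^ 2 / 8) ≤ m * (α ^ 2 * m ^ 2 / 8) := by gcongr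
    have e2 : 16 / α * ∑ b ∈ B, bad b ≤ 16 / α * (α ^ 3 / 128 * m * m ^ 2) := by gcongr
    have e3 : 16 / α * (α ^ 3 / 128 * m * m ^ 2) = α ^ 2 * m ^ 3 / 8 := by field_simp; norm_num
    nlinarith
  set A1 := N b0 with hA1
  have hA1s : A1 ⊆ A0 := by rw [hA1, hN]; exact filter_subset _ _
  replace hbadnn := hbadnn b0
  have hA1c : α * m / 3 ≤ #A1 := by
    refine (pow_le_pow_iff_left₀ (by positivity) (by positivity) two_ne_zero).1 ?_
    have : 0 ≤ 16 / α * bad b0 := by positivity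
    nlinarith [mul_pos hα hm, sq_nonneg (α * m)]
  have hA1p : (0 : ℝ) < #A1 := lt_of_lt_of_le (by positivity) hA1c
  have hbad1 : bad b0 ≤ α / 16 * (#A1 : ℝ) ^ 2 := by
    have : 16 / α * bad b0 ≤ (#A1 : ℝ) ^ 2 := by nlinarith [sq_nonneg (α * m)]
    rw [div_mul_eq_mul_div, div_le_iff₀ hα] at this
    linarith
  set bd1 : G → ℝ := fun a => (#{a' ∈ A1 | (a, a') ∈ Bd} : ℝ) with hbd1
  have hbd1s : ∑ a ∈ A1, bd1 a = bad b0 := by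
    simp only [hbd1, hbad]
    norm_cast
    rw [card_eq_sum_card_fiberwise (f := Prod.fst) (t := A1)]
    · refine sum_congr rfl fun a ha => ?_
      refine card_bij (fun b _ => (a, b)) ?_ ?_ ?_
      · intro b hb
        simp only [hA1, hN, mem_filter] at ha hb ⊢
        tauto
      · intro b _ b' _ h; simpa using h
      · rintro ⟨a', b⟩ hb
        simp only [mem_filter] at hb
        obtain ⟨⟨hb, hb1, hb2⟩, rfl⟩ := hb
        refine ⟨b, ?_, rfl⟩
        have := (mem_product.1 (mem_filter.1 hb).1).2
        simp only [hA1, hN, mem_filter]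
        exact ⟨⟨this, hb2⟩, hb⟩
    · intro x hx
      simp only [coe_filter, Set.mem_ofPred_eq] at hx
      have := (mem_product.1 (mem_filter.1 hx.1).1).1
      simp only [hA1, hN, coe_filter, Set.mem_ofPred_eq]
      exact ⟨this, hx.2.1⟩
  set A' := {a ∈ A1 | ¬ α / 8 * #A1 ≤ bd1 a} with hA'
  have hA'c : (#A1 : ℝ) / 2 ≤ #A' := by
    have e1 : (#{a ∈ A1 | α / 8 * #A1 ≤ bd1 a} : ℝ) * (α / 8 * #A1) ≤ α / 16 * (#A1 : ℝ) ^ 2 := by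
      refine le_trans ?_ hbad1
      rw [← hbd1s, ← nsmul_eq_mul]
      refine le_trans (Finset.card_nsmul_le_sum _ _ _ fun a ha => (mem_filter.1 ha).2) ?_
      exact sum_le_sum_of_subset_of_nonneg (filter_subset _ _) fun _ _ _ => by positivity
    have e2 : (#{a ∈ A1 | α / 8 * #A1 ≤ bd1 a} : ℝ) + #A' = #A1 := by
      exact_mod_cast card_filter_add_card_filter_not (s := A1) (fun a => α / 8 * #A1 ≤ bd1 a)
    have e3 : (#{a ∈ A1 | α / 8 * #A1 ≤ bd1 a} : ℝ) ≤ #A1 / 2 := by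
      have : (0 : ℝ) < α / 8 * #A1 := by positivity
      refine le_of_mul_le_mul_right (e1.trans (le_of_eq ?_)) this
      ring
    linarith
  set f : G → ℝ := fun b => (#{a ∈ A1 | (a, b) ∈ E} : ℝ) with hf
  have hfs : (#A1 : ℝ) * (α * m / 2) ≤ ∑ b ∈ B, f b := by
    rw [hf, ← dcount A1 B (fun a b => (a, b) ∈ E), ← nsmul_eq_mul]
    refine card_nsmul_le_sum _ _ _ fun a ha => ?_
    have := (mem_filter.1 (hA1s ha)).2
    rwa [hdeg] at this
  set B' := {b ∈ B | α / 4 * #A1 ≤ f b} with hB'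
  have hB'c : α * m / 4 ≤ #B' := by
    have := popular' B f (α / 4 * #A1) #A1 m (fun b _ => card_le_of (filter_subset _ _) le_rfl)
      (by positivity) hB
    have h' : (α * m / 4) * #A1 ≤ #B' * #A1 := by
      rw [← hB'] at this
      nlinarith
    exact le_of_mul_le_mul_right h' hA1p
  refine ⟨A', (filter_subset _ _).trans (hA1s.trans hA0s), B', filter_subset _ _, ?_, ?_, ?_⟩
  · nlinarith [mul_pos hα hm]
  · nlinarith [mul_pos hα hm]
  have key : ∀ s ∈ A' + B', (α / 16) ^ 5 * m ^ 2 ≤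
      (#{t ∈ S ×ˢ S ×ˢ S | t.1 - t.2.1 + t.2.2 = s} : ℝ) := by
    intro s hs
    obtain ⟨a, ha, b, hb, rfl⟩ := mem_add.1 hs
    set g := {a' ∈ A1 | (a', b) ∈ E ∧ (a, a') ∉ Bd} with hg
    have ha1 := (mem_filter.1 ha).1
    have hgc : α / 8 * #A1 ≤ #g := by
      have e1 : f b ≤ #g + bd1 a := by
        simp only [hf, hg, hbd1]
        norm_cast
        rw [← card_filter_add_card_filter_not (s := {a ∈ A1 | (a, b) ∈ E}) (fun a' => (a, a') ∉ Bd),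
          filter_filter]
        gcongr
        intro x hx
        simp only [mem_filter, not_not] at hx ⊢
        tauto
      have e2 := (mem_filter.1 hb).2
      have e3 := (mem_filter.1 ha).2
      linarith
    have e4 : (α ^ 3 / 128 * m) * #g ≤
        #(g.sigma fun a' => {b' ∈ B | (a, b') ∈ E ∧ (a', b') ∈ E}) := by
      rw [card_sigma, mul_comm, ← nsmul_eq_mul]
      push_cast
      refine card_nsmul_le_sum _ _ _ fun a' ha' => ?_
      simp only [hg, mem_filter] at ha'
      have : (a, a') ∉ Bd := ha'.2.2
      simp only [hBd, mem_filter, mem_product, not_and, not_lt] at this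
      have := this ⟨hA1s ha1, hA1s ha'.1⟩
      rwa [hcodeg] at this
    have e5 : #(g.sigma fun a' => {b' ∈ B | (a, b') ∈ E ∧ (a', b') ∈ E}) ≤
        #{t ∈ S ×ˢ S ×ˢ S | t.1 - t.2.1 + t.2.2 = a + b} := by
      refine card_le_card_of_injOn (fun x => (a + x.2, x.1 + x.2, x.1 + b)) ?_ ?_
      · rintro ⟨a', b'⟩ hx
        simp only [hg, coe_sigma, Set.mem_sigma_iff, mem_coe, mem_filter] at hx
        simp only [mem_coe, mem_filter, mem_product]
        refine ⟨⟨hS (a, b') hx.2.2.1, hS (a', b') hx.2.2.2, hS (a', b) hx.1.2.1⟩, by abel⟩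
      · rintro ⟨a', b'⟩ _ ⟨a'', b''⟩ _ h
        simp only [Prod.mk.injEq, add_right_inj, add_left_inj] at h
        obtain ⟨rfl, -, rfl⟩ := h
        rfl
    refine le_trans ?_ (e4.trans (by exact_mod_cast e5))
    have : α / 8 * (α * m / 3) ≤ #g := le_trans (by gcongr) hgc
    calc (α / 16) ^ 5 * m ^ 2 ≤ (α ^ 3 / 128 * m) * (α / 8 * (α * m / 3)) := by
          have : 0 ≤ α ^ 5 * m ^ 2 := by positivity
          nlinarith
      _ ≤ _ := by gcongr
  have h6 : (#(A' + B') : ℝ) * ((α / 16) ^ 5 * m ^ 2) ≤ m ^ 3 := by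
    rw [← nsmul_eq_mul]
    refine (card_nsmul_le_sum _ _ _ key).trans ?_
    have : ∑ s ∈ A' + B', #{t ∈ S ×ˢ S ×ˢ S | t.1 - t.2.1 + t.2.2 = s} ≤ #(S ×ˢ S ×ˢ S) :=
      (sum_card_fiberwise_eq_card_filter ..).trans_le (card_le_card (filter_subset _ _))
    refine le_trans (by exact_mod_cast this : _ ≤ ((#(S ×ˢ S ×ˢ S) : ℕ) : ℝ)) ?_
    rw [card_product, card_product]; push_cast
    have hs0 : (0 : ℝ) ≤ #S := by positivity
    calc (#S : ℝ) * (#S * #S) ≤ m * (m * m) := by gcongr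
      _ = m ^ 3 := by ring
  have h7 : (α / 16) ^ 5 * #(A' + B') * m ^ 2 ≤ m * m ^ 2 := by linarith
  exact le_of_mul_le_mul_right h7 (by positivity)

theorem pivot (p : ℕ) [Fact p.Prime] (B : Finset (ZMod p)) (hB : 2 ≤ #B) :
    ∃ b₁ ∈ B, ∃ b₂ ∈ B, ∃ b₃ ∈ B, ∃ b₄ ∈ B, b₃ ≠ b₄ ∧ ∃ η : ZMod p, η ≠ 0 ∧
      η * (b₃ - b₄) = (b₁ - b₂) + (b₃ - b₄) ∧
      (#B ^ 2 ≤ 2 * #(B + η • B) ∨ p ≤ 4 * #(B + η • B)) := by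
  classical
  let R : ZMod p → Prop := fun ξ => ∃ b₁ ∈ B, ∃ b₂ ∈ B, ∃ b₃ ∈ B, ∃ b₄ ∈ B, b₃ ≠ b₄ ∧
    ξ * (b₃ - b₄) = b₁ - b₂
  obtain ⟨u, hu, v, hv, huv⟩ := one_lt_card.1 (by omega : 1 < #B)
  have hR0 : R 0 := ⟨u, hu, u, hu, u, hu, v, hv, huv, by simp⟩
  suffices h : ∃ η : ZMod p, η ≠ 0 ∧ R (η - 1) ∧
      (#B ^ 2 ≤ 2 * #(B + η • B) ∨ p ≤ 4 * #(B + η • B)) by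
    obtain ⟨η, hη, ⟨b₁, h₁, b₂, h₂, b₃, h₃, b₄, h₄, hne, h⟩, hc⟩ := h
    refine ⟨b₁, h₁, b₂, h₂, b₃, h₃, b₄, h₄, hne, η, hη, ?_, hc⟩
    linear_combination h
  by_cases hall : ∀ ξ, R ξ → R (ξ + 1)
  · have hR : ∀ ξ, R ξ := by
      intro ξ
      have : ∀ k : ℕ, R (k : ZMod p) := by
        intro k
        induction k with
        | zero => simpa using hR0
        | succ k ih => simpa using hall _ ih
      simpa using this ξ.val
    let T := (B ×ˢ B) ×ˢ (B ×ˢ B)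
    let Q : ZMod p → ℕ := fun η =>
      #{x ∈ T | x.1.1 + η * x.2.1 = x.1.2 + η * x.2.2}
    let D : Finset (ZMod p) := univ.erase 0
    have hD : #D = p - 1 := by simp [D, ZMod.card]
    have hp := (Fact.out : p.Prime).two_le
    have hsum : ∑ η ∈ D, Q η ≤ (p - 1) * #B ^ 2 + #B ^ 4 := by
      have e : ∑ η ∈ D, Q η =
          ∑ x ∈ T, #{η ∈ D | x.1.1 + η * x.2.1 = x.1.2 + η * x.2.2} :=
        Finset.sum_card_bipartiteAbove_eq_sum_card_bipartiteBelow
          (fun (η : ZMod p) (x : (ZMod p × ZMod p) × (ZMod p × ZMod p)) =>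
            x.1.1 + η * x.2.1 = x.1.2 + η * x.2.2)
      rw [e]
      have e2 : ∀ x ∈ T, #{η ∈ D | x.1.1 + η * x.2.1 = x.1.2 + η * x.2.2} ≤
          (if x.1.1 = x.1.2 ∧ x.2.1 = x.2.2 then (p - 1) else 0) + 1 := by
        rintro ⟨⟨a, c⟩, b, d⟩ _
        split_ifs with h
        · refine le_trans (card_le_card (filter_subset _ _)) ?_
          rw [hD]; omega
        · rw [zero_add, card_le_one]
          intro η hη η' hη'
          simp only [mem_filter] at hη hη' h
          have h1 := hη.2
          have h2 := hη'.2
          have h3 : (η - η') * (b - d) = 0 := by linear_combination h1 - h2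
          rcases mul_eq_zero.1 h3 with h3 | h3
          · exact sub_eq_zero.1 h3
          · exfalso
            have h4 : b = d := sub_eq_zero.1 h3
            subst h4
            exact h ⟨by simpa using h1, rfl⟩
      refine (sum_le_sum e2).trans ?_
      rw [sum_add_distrib, ← sum_filter, sum_const, sum_const, smul_eq_mul, smul_eq_mul, mul_one]
      have hT : #T = #B ^ 4 := by simp only [T, card_product]; ring
      rw [hT, mul_comm]
      gcongr
      rw [sq, ← card_product]
      refine card_le_card_of_injOn (fun x => (x.1.1, x.2.1)) ?_ ?_
      · rintro ⟨⟨a, c⟩, b, d⟩ h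
        simp only [T, mem_coe, mem_filter, mem_product] at h ⊢
        exact ⟨h.1.1.1, h.1.2.1⟩
      · rintro ⟨⟨a, c⟩, b, d⟩ h ⟨⟨a', c'⟩, b', d'⟩ h' hh
        simp only [mem_coe, mem_filter, Prod.mk.injEq] at h h' hh ⊢
        obtain ⟨-, rfl, rfl⟩ := h
        obtain ⟨-, rfl, rfl⟩ := h'
        tauto
    obtain ⟨η, hη, hQ⟩ : ∃ η ∈ D, (p - 1) * Q η ≤ (p - 1) * #B ^ 2 + #B ^ 4 := by
      refine exists_le_of_sum_le ⟨1, by simp [D]⟩ ?_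
      rw [← mul_sum, sum_const, smul_eq_mul, hD]
      gcongr
    have hη0 : η ≠ 0 := by simpa [D] using hη
    refine ⟨η, hη0, hR _, ?_⟩
    have hE : addEnergy B (η • B) ≤ Q η := by
      unfold addEnergy
      refine card_le_card_of_surjOn (fun x => (x.1, (η * x.2.1, η * x.2.2))) ?_
      rintro ⟨⟨a, c⟩, b, d⟩ h
      simp only [mem_coe, mem_filter, mem_product, mem_smul_finset] at h
      obtain ⟨⟨⟨ha, hc⟩, ⟨b, hb, rfl⟩, ⟨d, hd, rfl⟩⟩, h⟩ := h
      refine ⟨((a, c), (b, d)), ?_, rfl⟩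
      simp only [T, mem_coe, mem_filter, mem_product]
      exact ⟨⟨⟨ha, hc⟩, hb, hd⟩, by simpa using h⟩
    have hCS := le_card_add_mul_addEnergy B (η • B)
    rw [card_smul_finset₀ hη0] at hCS
    have hCS' : #B ^ 4 ≤ #(B + η • B) * Q η := by
      calc #B ^ 4 = #B ^ 2 * #B ^ 2 := by ring
        _ ≤ _ := hCS.trans (by gcongr)
    have hpos : 0 < #(B + η • B) := by
      by_contra h0
      have : #(B + η • B) = 0 := by omega
      rw [this, zero_mul] at hCS'
      have : 0 < #B ^ 4 := by positivity
      omega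
    generalize #(B + η • B) = e at *
    generalize Q η = q at *
    obtain ⟨r, rfl⟩ : ∃ r, p = r + 1 := ⟨p - 1, by omega⟩
    simp only [Nat.add_sub_cancel] at hQ
    have hs : 0 < #B := by omega
    generalize #B = s at *
    have hr : 0 < r := by omega
    rcases le_total (s ^ 2) r with h | h
    · left
      have h1 : r * q ≤ r * (2 * s ^ 2) := by nlinarith
      have h2 : q ≤ 2 * s ^ 2 := Nat.le_of_mul_le_mul_left h1 hr
      have h3 : s ^ 2 * s ^ 2 ≤ s ^ 2 * (2 * e) := by nlinarith
      exact Nat.le_of_mul_le_mul_left h3 (by positivity)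
    · right
      have h1 : r * q ≤ 2 * s ^ 4 := by nlinarith
      have h3 : s ^ 4 * r ≤ s ^ 4 * (2 * e) := by nlinarith
      have := Nat.le_of_mul_le_mul_left h3 (by positivity)
      omega
  · push Not at hall
    obtain ⟨ξ, hξ, hξ'⟩ := hall
    refine ⟨ξ + 1, ?_, by simpa using hξ, Or.inl ?_⟩
    · intro h; rw [h] at hξ'; exact hξ' hR0
    · have : #(B ×ˢ B) ≤ #(B + (ξ + 1) • B) := by
        refine card_le_card_of_injOn (fun x => x.1 + (ξ + 1) * x.2) ?_ ?_
        · rintro ⟨a, b⟩ h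
          simp only [mem_coe, mem_product] at h ⊢
          exact add_mem_add h.1 (smul_mem_smul_finset h.2)
        · rintro ⟨a, b⟩ h ⟨c, d⟩ h' hh
          simp only [mem_coe, mem_product] at h h' hh
          by_cases hbd : b = d
          · subst hbd; simpa using hh
          · exact absurd ⟨c, h'.1, a, h.1, b, h.2, d, h'.2, hbd, by linear_combination hh⟩ hξ'
      rw [card_product] at this
      nlinarith

theorem tri {G : Type*} [AddCommGroup G] [DecidableEq G] (A B C : Finset G) :
    (#(A + C) : ℝ) * #B ≤ #(A + B) * #(B + C) := by
  exact_mod_cast ruzsa_triangle_inequality_add_add_add A B C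

theorem pr_sub {G : Type*} [AddCommGroup G] [DecidableEq G] {A : Finset G} (hA : A.Nonempty)
    (B : Finset G) (m n : ℕ) :
    (#(m • B - n • B) : ℝ) ≤ ((#(A + B) : ℝ) / #A) ^ (m + n) * #A := by
  have := pluennecke_ruzsa_inequality_nsmul_sub_nsmul_add hA B m n
  have h := (NNRat.cast_le (K := ℝ)).2 this
  push_cast at h
  exact h

theorem pr_add {G : Type*} [AddCommGroup G] [DecidableEq G] {A : Finset G} (hA : A.Nonempty)
    (B : Finset G) (n : ℕ) :
    (#(n • B) : ℝ) ≤ ((#(A + B) : ℝ) / #A) ^ n * #A := by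
  have := pluennecke_ruzsa_inequality_nsmul_add hA B n
  have h := (NNRat.cast_le (K := ℝ)).2 this
  push_cast at h
  exact h

theorem pow_aux {β m u x c : ℝ} (k j : ℕ) (hβ : 0 < β) (hx : 0 < x) (hxm : x ≤ m) (hu : 0 ≤ u)
    (h1 : β * m ≤ x) (h2 : β ^ k * u ≤ c * m) (hc : 0 ≤ c) :
    β ^ ((k + 1) * j) * ((u / x) ^ j * x) ≤ c ^ j * m := by
  have h3 : β ^ (k + 1) * (u / x) ≤ c := by
    rw [← mul_div_assoc, div_le_iff₀ hx, pow_succ']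
    calc β * β ^ k * u = β * (β ^ k * u) := by ring
      _ ≤ β * (c * m) := by gcongr
      _ = c * (β * m) := by ring
      _ ≤ c * x := by gcongr
  calc β ^ ((k + 1) * j) * ((u / x) ^ j * x) = (β ^ (k + 1) * (u / x)) ^ j * x := by
        rw [pow_mul, mul_pow]; ring
    _ ≤ c ^ j * m := by gcongr

theorem div_aux {β m a y s t c d : ℝ} (i j : ℕ) (hβ : 0 < β) (hm : 0 < m) (ht : 0 ≤ t)
    (h : a * y ≤ s * t) (hs : β ^ i * s ≤ c * m) (ht' : β ^ j * t ≤ d * m) (hy : β * m ≤ y)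
    (hc : 0 ≤ c) (ha : 0 ≤ a) :
    β ^ (i + j + 1) * a ≤ c * d * m := by
  have h1 : m * (β ^ (i + j + 1) * a) ≤ m * (c * d * m) := by
    calc m * (β ^ (i + j + 1) * a) = β ^ (i + j) * (a * (β * m)) := by ring
      _ ≤ β ^ (i + j) * (a * y) := by gcongr
      _ ≤ β ^ (i + j) * (s * t) := by gcongr
      _ = (β ^ i * s) * (β ^ j * t) := by ring
      _ ≤ (c * m) * (d * m) := by gcongr
      _ = m * (c * d * m) := by ring
  exact le_of_mul_le_mul_left h1 hm

theorem upper {F : Type*} [Field F] [DecidableEq F] (X Y : Finset F) (l0 : F) (hl0 : l0 ≠ 0)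
    (β m : ℝ) (hβ : 0 < β) (hm : 0 < m) (hXm : #X ≤ m) 
    (hX : β * m ≤ #X) (hY : β * m ≤ #Y) (h0 : β ^ 5 * #(X + l0 • Y) ≤ m)
    (b₁ b₂ b₃ b₄ : F) (h₁ : β ^ 31 * #(X + b₁ • Y) ≤ 2 * m)
    (h₂ : β ^ 31 * #(X + b₂ • Y) ≤ 2 * m) (h₃ : β ^ 31 * #(X + b₃ • Y) ≤ 2 * m)
    (h₄ : β ^ 31 * #(X + b₄ • Y) ≤ 2 * m) (hne : b₃ ≠ b₄) (η : F) (hη : η ≠ 0)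
    (hη' : η * (b₃ - b₄) = (b₁ - b₂) + (b₃ - b₄)) :
    β ^ 159 * #(X + η • X) ≤ 8 ^ 4 * m := by
  classical
  have hXp : (0 : ℝ) < #X := lt_of_lt_of_le (by positivity) hX
  have hXne : X.Nonempty := by
    rw [← card_pos]; exact_mod_cast hXp
  set U := (b₁ • Y ∪ b₂ • Y) ∪ (b₃ • Y ∪ b₄ • Y) with hU
  have hXU : β ^ 31 * #(X + U) ≤ 8 * m := by
    have e : #(X + U) ≤ (#(X + b₁ • Y) + #(X + b₂ • Y)) + (#(X + b₃ • Y) + #(X + b₄ • Y)) := by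
      rw [hU, add_union, add_union, add_union]
      refine (card_union_le _ _).trans ?_
      gcongr <;> exact card_union_le _ _
    have e' : (#(X + U) : ℝ) ≤ (#(X + b₁ • Y) + #(X + b₂ • Y)) + (#(X + b₃ • Y) + #(X + b₄ • Y)) := by
      exact_mod_cast e
    have : β ^ 31 * (#(X + U) : ℝ) ≤ β ^ 31 * ((#(X + b₁ • Y) + #(X + b₂ • Y)) + (#(X + b₃ • Y) + #(X + b₄ • Y))) := by
      gcongr
    linarith
  have s1 : β ^ 128 * (#(2 • U - 2 • U) : ℝ) ≤ 8 ^ 4 * m := by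
    refine le_trans ?_ (pow_aux (u := #(X + U)) 31 4 hβ hXp hXm (by positivity) hX hXU (by norm_num))
    have := pr_sub hXne U 2 2
    norm_num at this ⊢
    gcongr
  have hb : b₃ - b₄ ≠ 0 := sub_ne_zero.2 hne
  have s2 : #(Y + (η - 1) • Y) ≤ #(2 • U - 2 • U) := by
    rw [← card_smul_finset₀ hb]
    apply card_le_card
    intro z hz
    obtain ⟨w, hw, rfl⟩ := mem_smul_finset.1 hz
    obtain ⟨y, hy, v, hv, rfl⟩ := mem_add.1 hw
    obtain ⟨y', hy', rfl⟩ := mem_smul_finset.1 hv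
    rw [two_nsmul]
    have m1 : ∀ {y}, y ∈ Y → b₁ * y ∈ U := fun {y} h => by
      simp only [hU, mem_union]; exact Or.inl (Or.inl (smul_mem_smul_finset h))
    have m2 : ∀ {y}, y ∈ Y → b₂ * y ∈ U := fun {y} h => by
      simp only [hU, mem_union]; exact Or.inl (Or.inr (smul_mem_smul_finset h))
    have m3 : ∀ {y}, y ∈ Y → b₃ * y ∈ U := fun {y} h => by
      simp only [hU, mem_union]; exact Or.inr (Or.inl (smul_mem_smul_finset h))
    have m4 : ∀ {y}, y ∈ Y → b₄ * y ∈ U := fun {y} h => by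
      simp only [hU, mem_union]; exact Or.inr (Or.inr (smul_mem_smul_finset h))
    have : (b₃ - b₄) • (y + (η - 1) • y') =
        (b₃ * y + b₁ * y') - (b₄ * y + b₂ * y') := by
      simp only [smul_eq_mul]
      linear_combination y' * hη'
    rw [this]
    exact sub_mem_sub (add_mem_add (m3 hy) (m1 hy')) (add_mem_add (m4 hy) (m2 hy'))
  have s3 : β ^ 128 * (#(Y + (η - 1) • Y) : ℝ) ≤ 8 ^ 4 * m := by
    refine le_trans ?_ s1
    have : (#(Y + (η - 1) • Y) : ℝ) ≤ #(2 • U - 2 • U) := by exact_mod_cast s2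
    gcongr
  have s4 : β ^ 18 * (#(Y + Y + Y) : ℝ) ≤ 1 * m := by
    have e : Y + Y + Y = 3 • Y := by rw [succ_nsmul, two_nsmul]
    have e2 : #(3 • Y) = #(3 • (l0 • Y)) := by
      rw [smul_comm, card_smul_finset₀ hl0]
    rw [e, e2]
    have := pow_aux (u := #(X + l0 • Y)) (c := 1) 5 3 hβ hXp hXm (by positivity) hX (by linarith)
      (by norm_num)
    refine le_trans ?_ (this.trans (by norm_num))
    have := pr_add hXne (l0 • Y) 3
    norm_num at this ⊢
    gcongr
  have s5 : β ^ 147 * (#(Y + Y + (η - 1) • Y) : ℝ) ≤ 8 ^ 4 * m := by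
    have := div_aux (a := (#(Y + Y + (η - 1) • Y) : ℝ)) 18 128 hβ hm (by positivity)
      (tri (Y + Y) Y ((η - 1) • Y)) s4 s3 hY (by norm_num) (by positivity)
    simpa using this
  have s6 : β ^ 147 * (#(Y + η • Y) : ℝ) ≤ 8 ^ 4 * m := by
    refine le_trans ?_ s5
    refine mul_le_mul_of_nonneg_left ?_ (by positivity)
    norm_cast
    apply card_le_card
    intro z hz
    obtain ⟨y, hy, v, hv, rfl⟩ := mem_add.1 hz
    obtain ⟨y', hy', rfl⟩ := mem_smul_finset.1 hv
    have : y + η • y' = y + y' + (η - 1) • y' := by simp only [smul_eq_mul]; ring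
    rw [this]
    exact add_mem_add (add_mem_add hy hy') (smul_mem_smul_finset hy')
  have s7 : β ^ 153 * (#(l0 • Y + η • X) : ℝ) ≤ 8 ^ 4 * m := by
    have t := tri (l0 • Y) (η • l0 • Y) (η • X)
    rw [smul_comm η l0 Y, ← smul_add l0, card_smul_finset₀ hl0, card_smul_finset₀ hl0,
      card_smul_finset₀ hη, smul_comm l0 η Y, ← smul_add η, card_smul_finset₀ hη,
      add_comm (l0 • Y) X] at t
    have := div_aux 147 5 (c := 8 ^ 4) (d := 1) hβ hm (by positivity) t s6 (by linarith) hY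
      (by norm_num) (by positivity)
    simpa using this
  have t := tri X (l0 • Y) (η • X)
  rw [card_smul_finset₀ hl0] at t
  have := div_aux 5 153 (c := 1) hβ hm (by positivity) t (by linarith) s7 hY
      (by norm_num) (by positivity)
  simpa using this

theorem slope_bound {F : Type*} [Field F] [DecidableEq F] (X Y Z W : Finset F) (l0 b : F)
    (hl0 : l0 ≠ 0) (hb : b ≠ 0) (hZ : Z ⊆ X) (hW : W ⊆ Y)
    (β m : ℝ) (hβ : 0 < β) (hm : 0 < m)
    (hX : β * m ≤ #X) (hY : β * m ≤ #Y) (h0 : β ^ 5 * #(X + l0 • Y) ≤ m)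
    (h1 : β ^ 5 * #(Z + b • W) ≤ m) (h2 : β ^ 4 * m ^ 2 / 2 ≤ #Z * #W) :
    β ^ 31 * #(X + b • Y) ≤ 2 * m := by
  have a1 : β ^ 11 * (#(X + X) : ℝ) ≤ m := by
    have t := tri X (l0 • Y) X
    rw [card_smul_finset₀ hl0, add_comm (l0 • Y) X] at t
    have := div_aux 5 5 (c := 1) (d := 1) hβ hm (by positivity) t (by linarith) (by linarith) hY
      (by norm_num) (by positivity)
    simpa using this
  have a2 : β ^ 11 * (#(Y + Y) : ℝ) ≤ m := by
    have t := tri (l0 • Y) X (l0 • Y)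
    rw [← smul_add, card_smul_finset₀ hl0, add_comm (l0 • Y) X] at t
    have := div_aux 5 5 (c := 1) (d := 1) hβ hm (by positivity) t (by linarith) (by linarith) hX
      (by norm_num) (by positivity)
    simpa using this
  have t1 : (#(X + b • Y) : ℝ) * #Z ≤ #(X + X) * #(Z + b • Y) := by
    refine (tri X Z (b • Y)).trans ?_
    gcongr
  have t2 : (#(Z + b • Y) : ℝ) * #W ≤ #(Z + b • W) * #(Y + Y) := by
    have := tri Z (b • W) (b • Y)
    rw [← smul_add, card_smul_finset₀ hb, card_smul_finset₀ hb] at this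
    refine this.trans ?_
    gcongr
  have t3 : (#(X + b • Y) : ℝ) * (#Z * #W) ≤ #(X + X) * (#(Z + b • W) * #(Y + Y)) := by
    calc (#(X + b • Y) : ℝ) * (#Z * #W) = (#(X + b • Y) * #Z) * #W := by ring
      _ ≤ (#(X + X) * #(Z + b • Y)) * #W := by gcongr
      _ = #(X + X) * (#(Z + b • Y) * #W) := by ring
      _ ≤ _ := by gcongr
  have t4 : m ^ 2 * (β ^ 31 * #(X + b • Y)) ≤ m ^ 2 * (2 * m) := by
    calc m ^ 2 * (β ^ 31 * (#(X + b • Y) : ℝ))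
        = 2 * β ^ 27 * (#(X + b • Y) * (β ^ 4 * m ^ 2 / 2)) := by ring
      _ ≤ 2 * β ^ 27 * (#(X + b • Y) * (#Z * #W)) := by gcongr
      _ ≤ 2 * β ^ 27 * (#(X + X) * (#(Z + b • W) * #(Y + Y))) := by gcongr
      _ = 2 * (β ^ 11 * #(X + X)) * ((β ^ 5 * #(Z + b • W)) * (β ^ 11 * #(Y + Y))) := by ring
      _ ≤ 2 * m * (m * m) := by gcongr
      _ = _ := by ring
  exact le_of_mul_le_mul_left t4 (by positivity)

theorem common_pair {F : Type*} [DecidableEq F] (A Bs : Finset F) (X Y : F → Finset F)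
    (β m : ℝ) (hβ : 0 < β) (hm : 0 < m) (hA : #A ≤ m) (hne : Bs.Nonempty)
    (hX : ∀ b ∈ Bs, X b ⊆ A) (hY : ∀ b ∈ Bs, Y b ⊆ A)
    (hXc : ∀ b ∈ Bs, β * m ≤ #(X b)) (hYc : ∀ b ∈ Bs, β * m ≤ #(Y b)) :
    ∃ b0 ∈ Bs, #Bs * (β ^ 4 / 2) ≤
      #{b ∈ Bs | β ^ 4 * m ^ 2 / 2 ≤ (#(X b ∩ X b0) : ℝ) * #(Y b ∩ Y b0)} := by
  have hBs : (0 : ℝ) < #Bs := by exact_mod_cast hne.card_pos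
  have hAA : (#(A ×ˢ A) : ℝ) ≤ m ^ 2 := by
    rw [card_product, sq]; push_cast; gcongr
  have hX' : ∀ b ∈ Bs, #{x ∈ A ×ˢ A | x ∈ X b ×ˢ Y b} = #(X b) * #(Y b) := by
    intro b hb
    rw [← card_product]
    congr 1
    ext ⟨x, y⟩
    simp only [mem_filter, mem_product]
    have := @hX b hb x
    have := @hY b hb y
    tauto
  have hsum : (#Bs : ℝ) * (β ^ 2 * m ^ 2) ≤
      ∑ x ∈ A ×ˢ A, (#{b ∈ Bs | x ∈ X b ×ˢ Y b} : ℝ) := by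
    rw [dcount, ← nsmul_eq_mul]
    refine card_nsmul_le_sum _ _ _ fun b hb => ?_
    rw [hX' b hb]
    push_cast
    calc β ^ 2 * m ^ 2 = (β * m) * (β * m) := by ring
      _ ≤ _ := by
        have := hXc b hb
        have := hYc b hb
        gcongr
  have hsq : ∑ x ∈ A ×ˢ A, (#{b ∈ Bs | x ∈ X b ×ˢ Y b} : ℝ) ^ 2 =
      ∑ b0 ∈ Bs, ∑ b ∈ Bs, (#(X b ∩ X b0) : ℝ) * #(Y b ∩ Y b0) := by
    have e1 : ∀ x : F × F, (#{b ∈ Bs | x ∈ X b ×ˢ Y b} : ℝ) ^ 2 =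
        #{b ∈ Bs ×ˢ Bs | x ∈ X b.1 ×ˢ Y b.1 ∧ x ∈ X b.2 ×ˢ Y b.2} := by
      intro x
      rw [sq]; norm_cast
      rw [← card_product]
      congr 1
      ext ⟨b, b'⟩
      simp only [mem_product, mem_filter]
      tauto
    simp_rw [e1]
    rw [dcount, sum_product]
    refine sum_congr rfl fun b0 hb0 => sum_congr rfl fun b hb => ?_
    norm_cast
    rw [← card_product]
    congr 1
    ext ⟨x, y⟩
    simp only [mem_filter, mem_product, mem_inter]
    have := @hX b hb x
    have := @hY b hb y
    tauto
  have hCS := sq_sum_le_card_mul_sum_sq (s := A ×ˢ A)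
    (f := fun x => (#{b ∈ Bs | x ∈ X b ×ˢ Y b} : ℝ))
  rw [hsq] at hCS
  have hbig : (#Bs : ℝ) * (#Bs * (β ^ 4 * m ^ 2)) ≤
      ∑ b0 ∈ Bs, ∑ b ∈ Bs, (#(X b ∩ X b0) : ℝ) * #(Y b ∩ Y b0) := by
    have h1 : m ^ 2 * ((#Bs : ℝ) * (#Bs * (β ^ 4 * m ^ 2))) ≤
      m ^ 2 * ∑ b0 ∈ Bs, ∑ b ∈ Bs, (#(X b ∩ X b0) : ℝ) * #(Y b ∩ Y b0) := by
      calc m ^ 2 * ((#Bs : ℝ) * (#Bs * (β ^ 4 * m ^ 2))) =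
          ((#Bs : ℝ) * (β ^ 2 * m ^ 2)) ^ 2 := by ring
        _ ≤ _ := pow_le_pow_left₀ (by positivity) hsum 2
        _ ≤ _ := hCS
        _ ≤ _ := by
          refine mul_le_mul_of_nonneg_right hAA ?_
          exact sum_nonneg fun _ _ => sum_nonneg fun _ _ => by positivity
    exact le_of_mul_le_mul_left h1 (by positivity)
  obtain ⟨b0, hb0, h⟩ : ∃ b0 ∈ Bs, (#Bs * (β ^ 4 * m ^ 2)) ≤
      ∑ b ∈ Bs, (#(X b ∩ X b0) : ℝ) * #(Y b ∩ Y b0) := by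
    refine exists_le_of_sum_le hne ?_
    rw [sum_const, nsmul_eq_mul]
    exact hbig
  refine ⟨b0, hb0, ?_⟩
  have hpop := popular' Bs (fun b => (#(X b ∩ X b0) : ℝ) * #(Y b ∩ Y b0)) (β ^ 4 * m ^ 2 / 2)
    (m ^ 2) #Bs (fun b hb => by
      rw [sq]
      have := card_le_of (inter_subset_left.trans (hX b hb) : X b ∩ X b0 ⊆ A) hA
      have := card_le_of (inter_subset_left.trans (hY b hb) : Y b ∩ Y b0 ⊆ A) hA
      gcongr) (by positivity) le_rfl
  have h2 := h.trans hpop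
  have h3 : (#Bs * (β ^ 4 / 2)) * m ^ 2 ≤
      #{b ∈ Bs | β ^ 4 * m ^ 2 / 2 ≤ (#(X b ∩ X b0) : ℝ) * #(Y b ∩ Y b0)} * m ^ 2 := by linarith
  exact le_of_mul_le_mul_right h3 (by positivity)

theorem energy_count {F : Type*} [Field F] [DecidableEq F] (X Y Z W : Finset F) (b : F)
    (hb : b ≠ 0) (hZ : Z ⊆ X) (hW : W ⊆ Y) (β m : ℝ) (hβ : 0 < β) (hm : 0 < m)
    (hX : #X ≤ m) (hY : #Y ≤ m)
    (h1 : β ^ 5 * #(Z + b • W) ≤ m) (h2 : β ^ 4 * m ^ 2 / 2 ≤ #Z * #W)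
    (hbig : 8 ≤ β ^ 13 * m) :
    β ^ 13 * m ^ 3 / 8 ≤
      #{t ∈ X ×ˢ Y ×ˢ Y | t.2.1 ≠ t.2.2 ∧ t.1 + b * (t.2.1 - t.2.2) ∈ X} := by
  have hE : addEnergy Z (b • W) ≤
      #{t ∈ X ×ˢ Y ×ˢ Y | t.1 + b * (t.2.1 - t.2.2) ∈ X} := by
    unfold addEnergy
    refine card_le_card_of_surjOn
      (fun t => ((t.1, t.1 + b * (t.2.1 - t.2.2)), (b * t.2.1, b * t.2.2))) ?_
    rintro ⟨⟨a, c⟩, u, v⟩ h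
    simp only [mem_coe, mem_filter, mem_product, mem_smul_finset] at h
    obtain ⟨⟨⟨ha, hc⟩, ⟨u, hu, rfl⟩, ⟨v, hv, rfl⟩⟩, h⟩ := h
    simp only [smul_eq_mul] at h
    have h' : a + b * (u - v) = c := by linear_combination h
    refine ⟨(a, u, v), ?_, ?_⟩
    · simp only [mem_coe, mem_filter, mem_product]
      rw [h']
      exact ⟨⟨hZ ha, hW hu, hW hv⟩, hZ hc⟩
    · simp [h']
  have hsplit : #{t ∈ X ×ˢ Y ×ˢ Y | t.1 + b * (t.2.1 - t.2.2) ∈ X} ≤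
      #{t ∈ X ×ˢ Y ×ˢ Y | t.2.1 ≠ t.2.2 ∧ t.1 + b * (t.2.1 - t.2.2) ∈ X} + #X * #Y := by
    rw [← card_filter_add_card_filter_not (s := {t ∈ X ×ˢ Y ×ˢ Y | t.1 + b * (t.2.1 - t.2.2) ∈ X})
      (fun t => t.2.1 ≠ t.2.2)]
    gcongr
    · intro t ht
      simp only [mem_filter] at ht ⊢
      tauto
    · rw [← card_product]
      refine card_le_card_of_injOn (fun t => (t.1, t.2.1)) ?_ ?_
      · rintro ⟨x, y, y'⟩ h
        simp only [mem_coe, mem_filter, mem_product] at h ⊢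
        exact ⟨h.1.1.1, h.1.1.2.1⟩
      · rintro ⟨x, y, y'⟩ h ⟨x1, y1, y1'⟩ h' hh
        simp only [mem_coe, mem_filter, not_not, Prod.mk.injEq] at h h' hh ⊢
        obtain ⟨-, rfl⟩ := h
        obtain ⟨-, rfl⟩ := h'
        tauto
  have hCS := le_card_add_mul_addEnergy Z (b • W)
  rw [card_smul_finset₀ hb] at hCS
  have hCS' : ((#Z : ℝ) * #W) ^ 2 ≤ #(Z + b • W) * addEnergy Z (b • W) := by
    rw [mul_pow]; exact_mod_cast hCS
  have hEr : (addEnergy Z (b • W) : ℝ) ≤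
      #{t ∈ X ×ˢ Y ×ˢ Y | t.2.1 ≠ t.2.2 ∧ t.1 + b * (t.2.1 - t.2.2) ∈ X} + #X * #Y := by
    exact_mod_cast hE.trans hsplit
  have hE2 : m * (β ^ 13 * m ^ 3 / 4) ≤ m * addEnergy Z (b • W) := by
    calc m * (β ^ 13 * m ^ 3 / 4) = β ^ 5 * (β ^ 4 * m ^ 2 / 2) ^ 2 := by ring
      _ ≤ β ^ 5 * ((#Z : ℝ) * #W) ^ 2 := by gcongr
      _ ≤ β ^ 5 * (#(Z + b • W) * addEnergy Z (b • W)) := by gcongr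
      _ = (β ^ 5 * #(Z + b • W)) * addEnergy Z (b • W) := by ring
      _ ≤ _ := by gcongr
  have hE3 := le_of_mul_le_mul_left hE2 hm
  have hXY : (#X : ℝ) * #Y ≤ m * m := by gcongr
  have : 8 * m ^ 2 ≤ (β ^ 13 * m) * m ^ 2 := by gcongr
  nlinarith

theorem key (p : ℕ) [Fact p.Prime] (A Bs : Finset (ZMod p)) (X Y : ZMod p → Finset (ZMod p))
    (β m : ℝ) (hβ : 0 < β) (hβ1 : β ≤ 1) (hm : 0 < m) (hA : #A ≤ m) (hBs : β * m ≤ #Bs)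
    (hne : ∀ b ∈ Bs, b ≠ 0)
    (hX : ∀ b ∈ Bs, X b ⊆ A) (hY : ∀ b ∈ Bs, Y b ⊆ A)
    (hXc : ∀ b ∈ Bs, β * m ≤ #(X b)) (hYc : ∀ b ∈ Bs, β * m ≤ #(Y b))
    (hXY : ∀ b ∈ Bs, β ^ 5 * #(X b + b • Y b) ≤ m) (hp : β * m ^ 2 ≤ p) :
    β ^ 195 * m ≤ 2 ^ 21 := by
  by_cases hbig : β ^ 18 * m < 32
  · calc β ^ 195 * m = β ^ 177 * (β ^ 18 * m) := by ring
      _ ≤ 1 * 32 := by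
        gcongr
        exact pow_le_one₀ hβ.le hβ1
      _ ≤ _ := by norm_num
  push Not at hbig
  have hbig13 : 8 ≤ β ^ 13 * m := by
    have : β ^ 18 * m ≤ β ^ 13 * m :=
      mul_le_mul_of_nonneg_right (pow_le_pow_of_le_one hβ.le hβ1 (by norm_num)) hm.le
    linarith
  have hBne : Bs.Nonempty := by
    rw [← card_pos]
    have : (0 : ℝ) < #Bs := lt_of_lt_of_le (by positivity) hBs
    exact_mod_cast this
  obtain ⟨b0, hb0, hB2⟩ := common_pair A Bs X Y β m hβ hm hA hBne hX hY hXc hYc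
  obtain ⟨B2, hB2def⟩ : ∃ B2, B2 =
    {b ∈ Bs | β ^ 4 * m ^ 2 / 2 ≤ (#(X b ∩ X b0) : ℝ) * #(Y b ∩ Y b0)} := ⟨_, rfl⟩
  rw [← hB2def] at hB2
  have hB2s : ∀ b ∈ B2, b ∈ Bs ∧ β ^ 4 * m ^ 2 / 2 ≤ (#(X b ∩ X b0) : ℝ) * #(Y b ∩ Y b0) := by
    intro b hb; rw [hB2def] at hb; exact mem_filter.1 hb
  have hB2c : β ^ 5 * m / 2 ≤ #B2 := by
    refine le_trans ?_ hB2
    calc β ^ 5 * m / 2 = β * m * (β ^ 4 / 2) := by ring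
      _ ≤ _ := by gcongr
  have hXm := card_le_of (hX b0 hb0) hA
  have hYm := card_le_of (hY b0 hb0) hA
  have hsmall : ∀ b ∈ B2, β ^ 5 * (#(X b ∩ X b0 + b • (Y b ∩ Y b0)) : ℝ) ≤ m := by
    intro b hb
    refine le_trans ?_ (hXY b (hB2s b hb).1)
    refine mul_le_mul_of_nonneg_left ?_ (by positivity)
    norm_cast
    exact card_le_card (add_subset_add inter_subset_left
      (smul_finset_subset_smul_finset inter_subset_left))
  have hcount : ∀ b ∈ B2, β ^ 13 * m ^ 3 / 8 ≤ (#{t ∈ X b0 ×ˢ Y b0 ×ˢ Y b0 |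
      t.2.1 ≠ t.2.2 ∧ t.1 + b * (t.2.1 - t.2.2) ∈ X b0} : ℝ) := fun b hb =>
    energy_count (X b0) (Y b0) _ _ b (hne b (hB2s b hb).1) inter_subset_right inter_subset_right
      β m hβ hm hXm hYm (hsmall b hb) (hB2s b hb).2 hbig13
  have hslope : ∀ b ∈ B2, β ^ 31 * (#(X b0 + b • Y b0) : ℝ) ≤ 2 * m := fun b hb =>
    slope_bound (X b0) (Y b0) _ _ b0 b (hne b0 hb0) (hne b (hB2s b hb).1) inter_subset_right
      inter_subset_right β m hβ hm (hXc b0 hb0) (hYc b0 hb0) (hXY b0 hb0) (hsmall b hb)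
      (hB2s b hb).2
  have htot := card_nsmul_le_sum B2 _ _ hcount
  rw [nsmul_eq_mul, dcount] at htot
  obtain ⟨t, ht, htc⟩ : ∃ t ∈ X b0 ×ˢ Y b0 ×ˢ Y b0, β ^ 18 * m / 16 ≤
      (#{b ∈ B2 | t.2.1 ≠ t.2.2 ∧ t.1 + b * (t.2.1 - t.2.2) ∈ X b0} : ℝ) := by
    refine exists_le_of_sum_le ?_ ?_
    · have h1 : (X b0).Nonempty := by
        rw [← card_pos]
        have : (0 : ℝ) < #(X b0) := lt_of_lt_of_le (by positivity) (hXc b0 hb0)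
        exact_mod_cast this
      have h2 : (Y b0).Nonempty := by
        rw [← card_pos]
        have : (0 : ℝ) < #(Y b0) := lt_of_lt_of_le (by positivity) (hYc b0 hb0)
        exact_mod_cast this
      exact h1.product (h2.product h2)
    · refine le_trans ?_ htot
      rw [sum_const, nsmul_eq_mul, card_product, card_product]
      push_cast
      calc (#(X b0) : ℝ) * (#(Y b0) * #(Y b0)) * (β ^ 18 * m / 16)
          ≤ m * (m * m) * (β ^ 18 * m / 16) := by gcongr
        _ = (β ^ 5 * m / 2) * (β ^ 13 * m ^ 3 / 8) := by ring
        _ ≤ _ := by gcongr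
  obtain ⟨z, w₁, w₂⟩ := t
  dsimp only at htc
  obtain ⟨B1, hB1⟩ : ∃ B1, B1 = {b ∈ B2 | w₁ ≠ w₂ ∧ z + b * (w₁ - w₂) ∈ X b0} := ⟨_, rfl⟩
  rw [← hB1] at htc
  have h2 : (2 : ℝ) ≤ #B1 := by linarith
  have h2' : 2 ≤ #B1 := by exact_mod_cast h2
  obtain ⟨b₁, h₁, b₂, h₂, b₃, h₃, b₄, h₄, hne34, η, hη, hη', hc⟩ := pivot p B1 h2'
  have hB1s : ∀ b ∈ B1, b ∈ B2 ∧ w₁ ≠ w₂ ∧ z + b * (w₁ - w₂) ∈ X b0 := by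
    intro b hb; rw [hB1] at hb; exact mem_filter.1 hb
  have hd : w₁ - w₂ ≠ 0 := sub_ne_zero.2 (hB1s b₁ h₁).2.1
  have hup := upper (X b0) (Y b0) b0 (hne b0 hb0) β m hβ hm hXm (hXc b0 hb0) (hYc b0 hb0)
    (hXY b0 hb0) b₁ b₂ b₃ b₄ (hslope _ (hB1s _ h₁).1) (hslope _ (hB1s _ h₂).1)
    (hslope _ (hB1s _ h₃).1) (hslope _ (hB1s _ h₄).1) hne34 η hη hη'
  have hle : #(B1 + η • B1) ≤ #(X b0 + η • X b0) := by
    refine card_le_card_of_injOn (fun s => (w₁ - w₂) * s + (z + η * z)) ?_ ?_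
    · intro s hs
      obtain ⟨b, hb, v, hv, rfl⟩ := mem_add.1 (mem_coe.1 hs)
      obtain ⟨b', hb', rfl⟩ := mem_smul_finset.1 hv
      have : (w₁ - w₂) * (b + η • b') + (z + η * z) =
          (z + b * (w₁ - w₂)) + η • (z + b' * (w₁ - w₂)) := by
        simp only [smul_eq_mul]; ring
      dsimp only
      rw [this]
      exact add_mem_add (hB1s b hb).2.2 (smul_mem_smul_finset (hB1s b' hb').2.2)
    · intro s _ s' _ h
      exact mul_left_cancel₀ hd (add_right_cancel h)
  have hup' : β ^ 159 * (#(B1 + η • B1) : ℝ) ≤ 8 ^ 4 * m := by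
    refine le_trans ?_ hup
    have : (#(B1 + η • B1) : ℝ) ≤ #(X b0 + η • X b0) := by exact_mod_cast hle
    gcongr
  rcases hc with hc | hc
  · have hc' : (#B1 : ℝ) ^ 2 ≤ 2 * #(B1 + η • B1) := by exact_mod_cast hc
    have e : m * (β ^ 195 * m) ≤ m * 2 ^ 21 := by
      calc m * (β ^ 195 * m) = 256 * β ^ 159 * (β ^ 18 * m / 16) ^ 2 := by ring
        _ ≤ 256 * β ^ 159 * (#B1 : ℝ) ^ 2 := by gcongr
        _ ≤ 256 * β ^ 159 * (2 * #(B1 + η • B1)) := by gcongr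
        _ = 512 * (β ^ 159 * #(B1 + η • B1)) := by ring
        _ ≤ 512 * (8 ^ 4 * m) := by gcongr
        _ = _ := by ring
    exact le_of_mul_le_mul_left e hm
  · have hc' : (p : ℝ) ≤ 4 * #(B1 + η • B1) := by exact_mod_cast hc
    have e : m * (β ^ 160 * m) ≤ m * 2 ^ 21 := by
      calc m * (β ^ 160 * m) = β ^ 159 * (β * m ^ 2) := by ring
        _ ≤ β ^ 159 * (4 * #(B1 + η • B1)) := 
          mul_le_mul_of_nonneg_left (hp.trans hc') (by positivity)
        _ = 4 * (β ^ 159 * #(B1 + η • B1)) := by ring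
        _ ≤ 4 * (8 ^ 4 * m) := by gcongr
        _ ≤ _ := by linarith
    refine le_trans ?_ (le_of_mul_le_mul_left e hm)
    exact mul_le_mul_of_nonneg_right (pow_le_pow_of_le_one hβ.le hβ1 (by norm_num)) hm.le

/-- one fibre: lines hitting `A` at b1, b2, b give a BSG instance -/
theorem fibre {F : Type*} [Field F] [DecidableEq F] (A : Finset F) (G : Finset (F × F))
    (b1 b2 b : F) (h12 : b1 ≠ b2) (hb1 : b ≠ b1) (hb2 : b ≠ b2) (m α : ℝ) (hm : 0 < m)
    (hα : 0 < α) (hA : #A ≤ m) (hG : α * m ^ 2 ≤ #G)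
    (h1 : ∀ l ∈ G, l.1 * b1 + l.2 ∈ A) (h2 : ∀ l ∈ G, l.1 * b2 + l.2 ∈ A)
    (h3 : ∀ l ∈ G, l.1 * b + l.2 ∈ A) :
    ∃ X ⊆ A, ∃ Y ⊆ A, α / 16 * m ≤ #X ∧ α / 16 * m ≤ #Y ∧
      (α / 16) ^ 5 * #(X + ((b - b1) / (b2 - b)) • Y) ≤ m := by
  have hd : b2 - b ≠ 0 := sub_ne_zero.2 hb2.symm
  have hn : b - b1 ≠ 0 := sub_ne_zero.2 hb1
  have hl : (b - b1) / (b2 - b) ≠ 0 := div_ne_zero hn hd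
  obtain ⟨c, hc⟩ : ∃ c, c = (b - b1) / (b2 - b) := ⟨_, rfl⟩
  rw [← hc] at hl ⊢
  obtain ⟨X, hX, Y', hY', hXc, hYc, hS⟩ := bsg A (c • A) (((b2 - b1) / (b2 - b)) • A)
    (G.image fun l => (l.1 * b1 + l.2, c * (l.1 * b2 + l.2))) (by
      intro e he
      obtain ⟨l, hl, rfl⟩ := mem_image.1 he
      exact mem_product.2 ⟨h1 l hl, smul_mem_smul_finset (h2 l hl)⟩) m α hm hα hA
    (by
      have : #(c • A) ≤ #A := card_image_le
      exact le_trans (by exact_mod_cast this) hA)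
    (by
      rw [card_image_of_injOn]
      · exact hG
      · rintro ⟨s, t⟩ _ ⟨s', t'⟩ _ h
        simp only [Prod.mk.injEq] at h
        obtain ⟨h, h'⟩ := h
        have h' := mul_left_cancel₀ hl h'
        have hs : (s - s') * (b2 - b1) = 0 := by linear_combination h' - h
        have hs : s = s' := by
          rcases mul_eq_zero.1 hs with h | h
          · exact sub_eq_zero.1 h
          · exact absurd (sub_eq_zero.1 h).symm h12
        subst hs
        simpa using h)
    (by
      intro e he
      obtain ⟨l, hl, rfl⟩ := mem_image.1 he
      refine mem_smul_finset.2 ⟨_, h3 l hl, ?_⟩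
      simp only [smul_eq_mul, hc]
      field_simp
      ring)
    (by
      have : #(((b2 - b1) / (b2 - b)) • A) ≤ #A := card_image_le
      exact le_trans (by exact_mod_cast this) hA)
  refine ⟨X, hX, c⁻¹ • Y', ?_, hXc, ?_, ?_⟩
  · intro y hy
    obtain ⟨z, hz, rfl⟩ := mem_smul_finset.1 hy
    obtain ⟨w, hw, rfl⟩ := mem_smul_finset.1 (hY' hz)
    simpa [smul_eq_mul, inv_mul_cancel_left₀ hl] using hw
  · have : #(c⁻¹ • Y') = #Y' := by
      refine card_image_of_injective _ fun x y h => ?_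
      exact mul_left_cancel₀ (inv_ne_zero hl) h
    rw [this]; exact hYc
  · rwa [smul_smul, mul_inv_cancel₀ hl, one_smul]

theorem triples {β : Type*} [DecidableEq β] (R : Finset β) (ρ : ℝ) (hρ : 4 ≤ ρ) (h : ρ ≤ #R) :
    (#R : ℝ) * (ρ ^ 2 / 4) ≤
      ∑ e ∈ R.offDiag, (#{b ∈ R | b ≠ e.1 ∧ b ≠ e.2} : ℝ) := by
  have h1 : ∀ e ∈ R.offDiag, (#R : ℝ) - 2 ≤ #{b ∈ R | b ≠ e.1 ∧ b ≠ e.2} := by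
    intro e he
    have : #R ≤ #{b ∈ R | b ≠ e.1 ∧ b ≠ e.2} + #({e.1, e.2} : Finset β) := by
      refine le_trans (card_le_card ?_) (card_union_le _ _)
      intro x hx
      simp only [mem_union, mem_filter, mem_insert, mem_singleton]
      tauto
    have h2 : #({e.1, e.2} : Finset β) ≤ 2 := card_le_two
    have : (#R : ℝ) ≤ #{b ∈ R | b ≠ e.1 ∧ b ≠ e.2} + 2 := by
      have h3 := this.trans (Nat.add_le_add_left h2 _)
      exact_mod_cast h3
    linarith
  have h2 := card_nsmul_le_sum _ _ _ h1
  refine le_trans ?_ h2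
  rw [nsmul_eq_mul, offDiag_card, Nat.cast_sub (Nat.le_mul_self _)]
  push_cast
  have e : ((#R : ℝ) * #R - #R) * (#R - 2) = #R * ((#R - 1) * (#R - 2)) := by ring
  rw [e]
  have : ρ ^ 2 / 4 ≤ ((#R : ℝ) - 1) * (#R - 2) := by nlinarith
  gcongr

theorem affine (p : ℕ) [Fact p.Prime] (A B : Finset (ZMod p)) (Λ : Finset (ZMod p × ZMod p))
    (m ρ α : ℝ) (hm : 0 < m) (hα : 0 < α) (hα1 : α ≤ 16) (hA : #A ≤ m) (hB : #B ≤ m)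
    (hρ : 4 ≤ ρ)
    (hJ : 2 * ρ * #Λ ≤ ∑ l ∈ Λ, (#{b ∈ B | l.1 * b + l.2 ∈ A} : ℝ))
    (hJ' : 16 * α * m ^ 5 ≤ (∑ l ∈ Λ, (#{b ∈ B | l.1 * b + l.2 ∈ A} : ℝ)) * ρ ^ 2)
    (hp : α / 16 * m ^ 2 ≤ p) : (α / 16) ^ 195 * m ≤ 2 ^ 21 := by
  classical
  obtain ⟨R, hR⟩ : ∃ R : ZMod p × ZMod p → Finset (ZMod p),
    R = fun l => {b ∈ B | l.1 * b + l.2 ∈ A} := ⟨_, rfl⟩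
  have hRd : ∀ l, {b ∈ B | l.1 * b + l.2 ∈ A} = R l := fun l => by rw [hR]
  have hRm : ∀ l b, b ∈ R l ↔ b ∈ B ∧ l.1 * b + l.2 ∈ A := fun l b => by
    rw [hR]; simp
  simp_rw [hRd] at hJ hJ'
  have hrich := popular_rich Λ (fun l => (#(R l) : ℝ)) ρ #Λ (by linarith) le_rfl
  have hrich2 : (∑ l ∈ Λ, (#(R l) : ℝ)) / 2 ≤ ∑ l ∈ Λ with ρ ≤ (#(R l) : ℝ), (#(R l) : ℝ) := by
    linarith
  -- triples
  have ht : 2 * α * m ^ 5 ≤ ∑ l ∈ Λ with ρ ≤ (#(R l) : ℝ),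
      ∑ e ∈ (R l).offDiag, (#{b ∈ R l | b ≠ e.1 ∧ b ≠ e.2} : ℝ) := by
    calc 2 * α * m ^ 5 ≤ ((∑ l ∈ Λ, (#(R l) : ℝ)) / 2) * (ρ ^ 2 / 4) := by linarith
      _ ≤ (∑ l ∈ Λ with ρ ≤ (#(R l) : ℝ), (#(R l) : ℝ)) * (ρ ^ 2 / 4) :=
        mul_le_mul_of_nonneg_right hrich2 (by positivity)
      _ = ∑ l ∈ Λ with ρ ≤ (#(R l) : ℝ), (#(R l) : ℝ) * (ρ ^ 2 / 4) := sum_mul _ _ _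
      _ ≤ _ := sum_le_sum fun l hl => triples _ _ hρ (mem_filter.1 hl).2
  obtain ⟨Λ', hΛ'⟩ : ∃ Λ', Λ' = Λ.filter fun l => ρ ≤ (#(R l) : ℝ) := ⟨_, rfl⟩
  rw [← hΛ'] at ht
  have ht2 : ∑ l ∈ Λ', ∑ e ∈ (R l).offDiag, (#{b ∈ R l | b ≠ e.1 ∧ b ≠ e.2} : ℝ) =
      ∑ e ∈ B.offDiag, ∑ b ∈ B with b ≠ e.1 ∧ b ≠ e.2,
        (#{l ∈ Λ' | e.1 ∈ R l ∧ e.2 ∈ R l ∧ b ∈ R l} : ℝ) := by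
    have e1 : ∀ e : ZMod p × ZMod p, ∑ b ∈ B with b ≠ e.1 ∧ b ≠ e.2,
        (#{l ∈ Λ' | e.1 ∈ R l ∧ e.2 ∈ R l ∧ b ∈ R l} : ℝ) =
        ∑ l ∈ Λ', (#{b ∈ {b ∈ B | b ≠ e.1 ∧ b ≠ e.2} | e.1 ∈ R l ∧ e.2 ∈ R l ∧ b ∈ R l} : ℝ) :=
      fun e => dcount _ _ fun b l => e.1 ∈ R l ∧ e.2 ∈ R l ∧ b ∈ R l
    simp_rw [e1]
    rw [sum_comm]
    refine sum_congr rfl fun l _ => ?_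
    have hsub : (R l).offDiag ⊆ B.offDiag := offDiag_mono fun b hb => ((hRm l b).1 hb).1
    rw [← sum_subset hsub]
    · refine sum_congr rfl fun e he => ?_
      have he := mem_offDiag.1 he
      congr 2
      ext b
      have := hRm l b
      simp only [mem_filter]
      tauto
    · intro e he he'
      have he := mem_offDiag.1 he
      rw [mem_offDiag] at he'
      rw [filter_eq_empty_iff.2]
      · simp
      · intro b _ h
        tauto
  rw [ht2] at ht
  have hoff : (#B.offDiag : ℝ) ≤ m ^ 2 := by
    have : #B.offDiag ≤ #B * #B := by rw [offDiag_card]; omega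
    calc (#B.offDiag : ℝ) ≤ #B * #B := by exact_mod_cast this
      _ ≤ m * m := by gcongr
      _ = m ^ 2 := by ring
  obtain ⟨⟨b1, b2⟩, hb, hG⟩ : ∃ e ∈ B.offDiag, 2 * α * m ^ 3 ≤ ∑ b ∈ B with b ≠ e.1 ∧ b ≠ e.2,
        (#{l ∈ Λ' | e.1 ∈ R l ∧ e.2 ∈ R l ∧ b ∈ R l} : ℝ) := by
    by_contra! hcon
    have hne : B.offDiag.Nonempty := by
      by_contra hemp
      rw [not_nonempty_iff_eq_empty] at hemp
      rw [hemp, sum_empty] at ht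
      have : 0 < 2 * α * m ^ 5 := by positivity
      linarith
    have h1 := sum_lt_sum_of_nonempty hne hcon
    rw [sum_const, nsmul_eq_mul] at h1
    have : (#B.offDiag : ℝ) * (2 * α * m ^ 3) ≤ m ^ 2 * (2 * α * m ^ 3) := by gcongr
    have : 2 * α * m ^ 5 = m ^ 2 * (2 * α * m ^ 3) := by ring
    linarith
  have hb := mem_offDiag.1 hb
  dsimp only at hb hG
  obtain ⟨-, -, h12⟩ := hb
  obtain ⟨G, hGdef⟩ : ∃ G : ZMod p → Finset (ZMod p × ZMod p),
    G = fun b => {l ∈ Λ' | b1 ∈ R l ∧ b2 ∈ R l ∧ b ∈ R l} := ⟨_, rfl⟩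
  have hGd : ∀ b, {l ∈ Λ' | b1 ∈ R l ∧ b2 ∈ R l ∧ b ∈ R l} = G b := fun b => by rw [hGdef]
  simp_rw [hGd] at hG
  have hGm : ∀ b, ∀ l ∈ G b, l.1 * b1 + l.2 ∈ A ∧ l.1 * b2 + l.2 ∈ A ∧ l.1 * b + l.2 ∈ A := by
    intro b l hl
    rw [hGdef] at hl
    have := (mem_filter.1 hl).2
    simp only [hRm] at this
    tauto
  have hGU : ∀ b, (#(G b) : ℝ) ≤ m ^ 2 := by
    intro b
    have : #(G b) ≤ #(A ×ˢ A) := by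
      refine card_le_card_of_injOn (fun l => (l.1 * b1 + l.2, l.1 * b2 + l.2)) ?_ ?_
      · intro l hl
        have := hGm b l hl
        exact mem_product.2 ⟨this.1, this.2.1⟩
      · rintro ⟨s, t⟩ _ ⟨s', t'⟩ _ h
        simp only [Prod.mk.injEq] at h
        obtain ⟨h, h'⟩ := h
        have hs : (s - s') * (b2 - b1) = 0 := by linear_combination h' - h
        have hs : s = s' := by
          rcases mul_eq_zero.1 hs with h | h
          · exact sub_eq_zero.1 h
          · exact absurd (sub_eq_zero.1 h).symm h12
        subst hs
        simpa using h
    rw [card_product] at this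
    calc (#(G b) : ℝ) ≤ #A * #A := by rw [← Nat.cast_mul]; exact Nat.cast_le.2 this
      _ ≤ m * m := mul_le_mul hA hA (Nat.cast_nonneg _) hm.le
      _ = m ^ 2 := by ring
  have hpop := popular' (B.filter fun b => b ≠ b1 ∧ b ≠ b2) (fun b => (#(G b) : ℝ)) (α * m ^ 2)
    (m ^ 2) m (fun b _ => hGU b) (by positivity) (card_le_of (filter_subset _ _) hB)
  obtain ⟨B', hB'⟩ : ∃ B', B' = (B.filter fun b => b ≠ b1 ∧ b ≠ b2).filter
    fun b => α * m ^ 2 ≤ (#(G b) : ℝ) := ⟨_, rfl⟩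
  rw [← hB'] at hpop
  have hB'c : α * m ≤ #B' := by
    have : (α * m) * m ^ 2 ≤ #B' * m ^ 2 := by
      have e : m * (α * m ^ 2) = (α * m) * m ^ 2 := by ring
      have e' : 2 * α * m ^ 3 = 2 * ((α * m) * m ^ 2) := by ring
      linarith
    exact le_of_mul_le_mul_right this (by positivity)
  have hB'm : ∀ b ∈ B', b ≠ b1 ∧ b ≠ b2 ∧ α * m ^ 2 ≤ (#(G b) : ℝ) := by
    intro b hb
    rw [hB'] at hb
    simp only [mem_filter] at hb
    tauto
  obtain ⟨lam, hlam⟩ : ∃ lam : ZMod p → ZMod p, lam = fun b => (b - b1) / (b2 - b) := ⟨_, rfl⟩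
  have hfib : ∀ c ∈ B'.image lam, ∃ X ⊆ A, ∃ Y ⊆ A, α / 16 * m ≤ #X ∧ α / 16 * m ≤ #Y ∧
      (α / 16) ^ 5 * #(X + c • Y) ≤ m := by
    intro c hc
    obtain ⟨b, hb, rfl⟩ := mem_image.1 hc
    obtain ⟨h1, h2, h3⟩ := hB'm b hb
    rw [hlam]
    exact fibre A (G b) b1 b2 b h12 h1 h2 m α hm hα hA h3 (fun l hl => (hGm b l hl).1)
      (fun l hl => (hGm b l hl).2.1) (fun l hl => (hGm b l hl).2.2)
  have hfib' : ∀ c, ∃ X Y : Finset (ZMod p), c ∈ B'.image lam → X ⊆ A ∧ Y ⊆ A ∧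
      α / 16 * m ≤ #X ∧ α / 16 * m ≤ #Y ∧ (α / 16) ^ 5 * #(X + c • Y) ≤ m := by
    intro c
    by_cases hc : c ∈ B'.image lam
    · obtain ⟨X, h1, Y, h2, h3⟩ := hfib c hc
      exact ⟨X, Y, fun _ => ⟨h1, h2, h3⟩⟩
    · exact ⟨∅, ∅, fun h => absurd h hc⟩
  choose X Y hXY using hfib'
  have hinj : Set.InjOn lam B' := by
    intro b hb b' hb' h
    obtain ⟨h1, h2, -⟩ := hB'm b hb
    obtain ⟨h1', h2', -⟩ := hB'm b' hb'
    rw [hlam] at h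
    dsimp only at h
    rw [div_eq_div_iff (sub_ne_zero.2 h2.symm) (sub_ne_zero.2 h2'.symm)] at h
    have : (b - b') * (b2 - b1) = 0 := by linear_combination h
    rcases mul_eq_zero.1 this with h | h
    · exact sub_eq_zero.1 h
    · exact absurd (sub_eq_zero.1 h).symm h12
  refine key p A (B'.image lam) X Y (α / 16) m (by positivity) (by linarith) hm hA ?_ ?_
    (fun c hc => (hXY c hc).1) (fun c hc => (hXY c hc).2.1) (fun c hc => (hXY c hc).2.2.1)
    (fun c hc => (hXY c hc).2.2.2.1) (fun c hc => (hXY c hc).2.2.2.2) hp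
  · rw [card_image_of_injOn hinj]
    have : 0 < α * m := by positivity
    linarith
  · intro c hc
    obtain ⟨b, hb, rfl⟩ := mem_image.1 hc
    obtain ⟨h1, h2, -⟩ := hB'm b hb
    rw [hlam]
    exact div_ne_zero (sub_ne_zero.2 h1) (sub_ne_zero.2 h2.symm)

theorem reach_card {Q M : Type*} [DecidableEq Q] [DecidableEq M] (P : Finset Q) (L : Finset M)
    (inc : Q → M → Prop) [∀ q l, Decidable (inc q l)]
    (hone : ∀ q ∈ P, ∀ q' ∈ P, q ≠ q' → ∀ l ∈ L, ∀ l' ∈ L, inc q l → inc q' l →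
      inc q l' → inc q' l' → l = l') (τ : ℝ) (hτ : 2 ≤ τ)
    (hr : ∀ l ∈ L, τ ≤ #{q ∈ P | inc q l}) (q : Q) (hq : q ∈ P) (hd : τ ≤ #{l ∈ L | inc q l})
    (l : M) :
    τ ^ 2 / 4 ≤ #{x ∈ P | x ≠ q ∧ ∃ l' ∈ L, l' ≠ l ∧ inc q l' ∧ inc x l'} := by
  have h1 : τ / 2 ≤ #{l' ∈ L | l' ≠ l ∧ inc q l'} := by
    have : #{l' ∈ L | inc q l'} ≤ #{l' ∈ L | l' ≠ l ∧ inc q l'} + #({l} : Finset M) := by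
      refine le_trans (card_le_card ?_) (card_union_le _ _)
      intro x hx
      simp only [mem_union, mem_filter, mem_singleton] at hx ⊢
      tauto
    rw [card_singleton] at this
    have : (#{l' ∈ L | inc q l'} : ℝ) ≤ #{l' ∈ L | l' ≠ l ∧ inc q l'} + 1 := by
      rw [← Nat.cast_add_one]; exact Nat.cast_le.2 this
    linarith
  have h2 : ∀ l' ∈ L, τ / 2 ≤ #{x ∈ P | x ≠ q ∧ inc x l'} := by
    intro l' hl'
    have : #{x ∈ P | inc x l'} ≤ #{x ∈ P | x ≠ q ∧ inc x l'} + #({q} : Finset Q) := by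
      refine le_trans (card_le_card ?_) (card_union_le _ _)
      intro x hx
      simp only [mem_union, mem_filter, mem_singleton] at hx ⊢
      tauto
    rw [card_singleton] at this
    have : (#{x ∈ P | inc x l'} : ℝ) ≤ #{x ∈ P | x ≠ q ∧ inc x l'} + 1 := by
      rw [← Nat.cast_add_one]; exact Nat.cast_le.2 this
    have := hr l' hl'
    linarith
  have h3 : #(({l' ∈ L | l' ≠ l ∧ inc q l'}).biUnion fun l' => {x ∈ P | x ≠ q ∧ inc x l'}) =
      ∑ l' ∈ {l' ∈ L | l' ≠ l ∧ inc q l'}, #{x ∈ P | x ≠ q ∧ inc x l'} := by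
    refine card_biUnion fun a ha b hb hab => ?_
    rw [Function.onFun, disjoint_left]
    intro x hx hx'
    simp only [coe_filter, Set.mem_ofPred_eq, mem_filter] at ha hb hx hx'
    exact hab (hone x hx.1 q hq hx.2.1 a ha.1 b hb.1 hx.2.2 ha.2.2 hx'.2.2 hb.2.2)
  have h4 : #(({l' ∈ L | l' ≠ l ∧ inc q l'}).biUnion fun l' => {x ∈ P | x ≠ q ∧ inc x l'}) ≤
      #{x ∈ P | x ≠ q ∧ ∃ l' ∈ L, l' ≠ l ∧ inc q l' ∧ inc x l'} := by
    refine card_le_card fun x hx => ?_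
    simp only [mem_biUnion, mem_filter] at hx ⊢
    obtain ⟨l', ⟨h, h', h''⟩, h3, h4, h5⟩ := hx
    exact ⟨h3, h4, l', h, h', h'', h5⟩
  rw [h3] at h4
  have h5 : (#{l' ∈ L | l' ≠ l ∧ inc q l'} : ℝ) * (τ / 2) ≤
      ∑ l' ∈ {l' ∈ L | l' ≠ l ∧ inc q l'}, (#{x ∈ P | x ≠ q ∧ inc x l'} : ℝ) := by
    rw [← nsmul_eq_mul]
    exact card_nsmul_le_sum _ _ _ fun l' hl' => h2 l' (mem_filter.1 hl').1
  calc τ ^ 2 / 4 = (τ / 2) * (τ / 2) := by ring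
    _ ≤ (#{l' ∈ L | l' ≠ l ∧ inc q l'} : ℝ) * (τ / 2) :=
      mul_le_mul_of_nonneg_right h1 (by linarith)
    _ ≤ _ := h5
    _ ≤ _ := by rw [← Nat.cast_sum]; exact Nat.cast_le.2 h4

theorem pairs_card {Q M : Type*} [DecidableEq Q] [DecidableEq M] (P : Finset Q) (L : Finset M)
    (inc : Q → M → Prop) [∀ q l, Decidable (inc q l)]
    (hone : ∀ q ∈ P, ∀ q' ∈ P, q ≠ q' → ∀ l ∈ L, ∀ l' ∈ L, inc q l → inc q' l →
      inc q l' → inc q' l' → l = l') (τ : ℝ) (hτ : 2 ≤ τ)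
    (hr : ∀ l ∈ L, τ ≤ #{q ∈ P | inc q l}) (q : Q) (hq : q ∈ P) (hd : τ ≤ #{l ∈ L | inc q l})
    (l : M) :
    τ ^ 4 / 16 ≤ #{e ∈ P ×ˢ P | e.1 ≠ q ∧ e.2 ≠ q ∧ ∃ l1 ∈ L, ∃ l2 ∈ L, l1 ≠ l2 ∧ l2 ≠ l ∧
      inc q l1 ∧ inc e.1 l1 ∧ inc q l2 ∧ inc e.2 l2} := by
  classical
  obtain ⟨R, hR⟩ : ∃ R : M → Finset Q, R = fun l =>
    {x ∈ P | x ≠ q ∧ ∃ l' ∈ L, l' ≠ l ∧ inc q l' ∧ inc x l'} := ⟨_, rfl⟩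
  have hRm : ∀ l x, x ∈ R l ↔ x ∈ P ∧ x ≠ q ∧ ∃ l' ∈ L, l' ≠ l ∧ inc q l' ∧ inc x l' := by
    intro l x; rw [hR]; simp
  have hRc : ∀ l, τ ^ 2 / 4 ≤ #(R l) := by
    intro l; rw [hR]; exact reach_card P L inc hone τ hτ hr q hq hd l
  have hg : ∀ x, ∃ l', x ∈ R l → l' ∈ L ∧ l' ≠ l ∧ inc q l' ∧ inc x l' := by
    intro x
    by_cases hx : x ∈ R l
    · obtain ⟨-, -, l', h⟩ := (hRm l x).1 hx
      exact ⟨l', fun _ => h⟩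
    · exact ⟨l, fun h => absurd h hx⟩
  choose g hg using hg
  have h1 : #((R l).sigma fun x => R (g x)) ≤ #{e ∈ P ×ˢ P | e.1 ≠ q ∧ e.2 ≠ q ∧
      ∃ l1 ∈ L, ∃ l2 ∈ L, l1 ≠ l2 ∧ l2 ≠ l ∧
      inc q l1 ∧ inc e.1 l1 ∧ inc q l2 ∧ inc e.2 l2} := by
    refine card_le_card_of_injOn (fun z => (z.2, z.1)) ?_ ?_
    · rintro ⟨x, y⟩ h
      obtain ⟨hx, hy⟩ := mem_sigma.1 (mem_coe.1 h)
      dsimp only at hx hy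
      obtain ⟨g1, g2, g3, g4⟩ := hg x hx
      obtain ⟨y1, y2, l1, y3, y4, y5, y6⟩ := (hRm _ _).1 hy
      obtain ⟨x1, x2, -⟩ := (hRm _ _).1 hx
      simp only [coe_filter, Set.mem_ofPred_eq, mem_product]
      exact ⟨⟨y1, x1⟩, y2, x2, l1, y3, g x, g1, y4, g2, y5, y6, g3, g4⟩
    · rintro ⟨x, y⟩ _ ⟨x', y'⟩ _ h
      simp only [Prod.mk.injEq] at h
      obtain ⟨rfl, rfl⟩ := h
      rfl
  rw [card_sigma] at h1
  have h2 : (#(R l) : ℝ) * (τ ^ 2 / 4) ≤ ∑ x ∈ R l, (#(R (g x)) : ℝ) := by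
    rw [← nsmul_eq_mul]
    exact card_nsmul_le_sum _ _ _ fun x _ => hRc _
  calc τ ^ 4 / 16 = (τ ^ 2 / 4) * (τ ^ 2 / 4) := by ring
    _ ≤ (#(R l) : ℝ) * (τ ^ 2 / 4) := mul_le_mul_of_nonneg_right (hRc l) (by positivity)
    _ ≤ _ := h2
    _ ≤ _ := by rw [← Nat.cast_sum]; exact Nat.cast_le.2 h1

theorem deg_sq {Q M : Type*} [DecidableEq Q] [DecidableEq M] (P : Finset Q) (L : Finset M)
    (inc : Q → M → Prop) [∀ q l, Decidable (inc q l)]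
    (hone : ∀ q ∈ P, ∀ q' ∈ P, q ≠ q' → ∀ l ∈ L, ∀ l' ∈ L, inc q l → inc q' l →
      inc q l' → inc q' l' → l = l') (n : ℝ) (hP : (#P : ℝ) ≤ n) (hL : (#L : ℝ) ≤ n)  :
    ∑ q ∈ P, (#{l ∈ L | inc q l} : ℝ) ^ 2 ≤ 2 * n ^ 2 := by
  have hn : 0 ≤ n := le_trans (Nat.cast_nonneg _) hP
  have e1 : ∀ q, (#{l ∈ L | inc q l} : ℝ) ^ 2 =
      #{e ∈ L ×ˢ L | inc q e.1 ∧ inc q e.2} := by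
    intro q
    rw [sq]; norm_cast
    rw [← card_product]
    congr 1
    ext ⟨b, b'⟩
    simp only [mem_product, mem_filter]
    tauto
  simp_rw [e1]
  rw [dcount, sum_product]
  have h1 : ∀ l ∈ L, ∑ l' ∈ L, (#{q ∈ P | inc q l ∧ inc q l'} : ℝ) ≤ n + n := by
    intro l hl
    rw [← sum_erase_add _ _ hl]
    refine add_le_add ?_ (card_le_of (filter_subset _ _) hP)
    refine le_trans (sum_le_card_nsmul _ _ 1 ?_) ?_
    · intro l' hl'
      obtain ⟨h1, h2⟩ := mem_erase.1 hl'
      have : #{q ∈ P | inc q l ∧ inc q l'} ≤ 1 := by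
        rw [card_le_one]
        intro a ha b hb
        by_contra hab
        simp only [mem_filter] at ha hb
        exact h1 (hone a ha.1 b hb.1 hab l hl l' h2 ha.2.1 hb.2.1 ha.2.2 hb.2.2).symm
      exact_mod_cast this
    · rw [nsmul_eq_mul, mul_one]
      exact card_le_of (erase_subset _ _) hL
  refine (sum_le_card_nsmul _ _ _ h1).trans ?_
  rw [nsmul_eq_mul]
  calc (#L : ℝ) * (n + n) ≤ n * (n + n) := mul_le_mul_of_nonneg_right hL (by linarith)
    _ = _ := by ring

theorem abstract_inc {Q M : Type*} [DecidableEq Q] [DecidableEq M] (P : Finset Q) (L : Finset M)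
    (inc : Q → M → Prop) [∀ q l, Decidable (inc q l)]
    (hone : ∀ q ∈ P, ∀ q' ∈ P, q ≠ q' → ∀ l ∈ L, ∀ l' ∈ L, inc q l → inc q' l →
      inc q l' → inc q' l' → l = l') (N K : ℝ) (hK : 0 < K) (hNK : 16 * K ≤ N)
    (hP : (#P : ℝ) ≤ N ^ 2) (hL : (#L : ℝ) ≤ N ^ 2)
    (hI : N ^ 3 / K ≤ ∑ q ∈ P, (#{l ∈ L | inc q l} : ℝ)) :
    ∃ p1 ∈ P, ∃ p2 ∈ P, (#{l ∈ L | inc p1 l} : ℝ) ≤ 4 * K * N ∧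
      (#{l ∈ L | inc p2 l} : ℝ) ≤ 4 * K * N ∧
      N ^ 3 / (8 ^ 6 * K ^ 5) ≤ #{f ∈ P ×ˢ L | inc f.1 f.2 ∧ p1 ≠ f.1 ∧ p2 ≠ f.1 ∧
        ∃ l1 ∈ L, ∃ l2 ∈ L, l1 ≠ l2 ∧ l2 ≠ f.2 ∧
        inc f.1 l1 ∧ inc p1 l1 ∧ inc f.1 l2 ∧ inc p2 l2} := by
  classical
  have hN : 0 < N := by linarith
  have hsq := deg_sq P L inc hone _ hP hL
  obtain ⟨P0, hP0⟩ : ∃ P0, P0 = P.filter fun q => (#{l ∈ L | inc q l} : ℝ) ≤ 4 * K * N := ⟨_, rfl⟩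
  have hP0P : P0 ⊆ P := by rw [hP0]; exact filter_subset _ _
  have hP0c := card_le_of hP0P hP
  have hI0 : N ^ 3 / (2 * K) ≤ ∑ q ∈ P0, (#{l ∈ L | inc q l} : ℝ) := by
    have h1 : (4 * K * N) * ∑ q ∈ P, (#{l ∈ L | inc q l} : ℝ) ≤
        (4 * K * N) * ∑ q ∈ P0, (#{l ∈ L | inc q l} : ℝ) +
          ∑ q ∈ P, (#{l ∈ L | inc q l} : ℝ) ^ 2 := by
      rw [hP0, sum_filter, mul_sum, mul_sum, ← sum_add_distrib]
      refine sum_le_sum fun q _ => ?_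
      split_ifs with h
      · have := sq_nonneg (#{l ∈ L | inc q l} : ℝ)
        linarith
      · push Not at h
        rw [mul_zero, zero_add, sq]
        exact mul_le_mul_of_nonneg_right h.le (Nat.cast_nonneg _)
    have h2 : (4 * K * N) * (N ^ 3 / K) ≤ (4 * K * N) * ∑ q ∈ P, (#{l ∈ L | inc q l} : ℝ) :=
      mul_le_mul_of_nonneg_left hI (by positivity)
    have h3 : (4 * K * N) * (N ^ 3 / K) = 4 * N ^ 4 := by field_simp
    have h4 : (4 * K * N) * (N ^ 3 / (2 * K)) = 2 * N ^ 4 := by field_simp; ring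
    have h5 : (4 * K * N) * (N ^ 3 / (2 * K)) ≤
        (4 * K * N) * ∑ q ∈ P0, (#{l ∈ L | inc q l} : ℝ) := by
      rw [h4]
      have : 2 * (N ^ 2) ^ 2 = 2 * N ^ 4 := by ring
      linarith
    exact le_of_mul_le_mul_left h5 (by positivity)
  obtain ⟨τ, hτ⟩ : ∃ τ, τ = N / (8 * K) := ⟨_, rfl⟩
  have hτ2 : 2 ≤ τ := by rw [hτ, le_div_iff₀ (by positivity)]; linarith
  rw [dcount] at hI0
  have hrich := popular_rich L (fun l => (#{q ∈ P0 | inc q l} : ℝ)) τ (N ^ 2) (by linarith) hL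
  obtain ⟨L1, hL1⟩ : ∃ L1, L1 = L.filter fun l => τ ≤ (#{q ∈ P0 | inc q l} : ℝ) := ⟨_, rfl⟩
  rw [← hL1] at hrich
  rw [← dcount P0 L1] at hrich
  have hL1L : L1 ⊆ L := by rw [hL1]; exact filter_subset _ _
  have hrich2 := popular_rich P0 (fun q => (#{l ∈ L1 | inc q l} : ℝ)) τ (N ^ 2) (by linarith) hP0c
  obtain ⟨P1, hP1⟩ : ∃ P1, P1 = P0.filter fun q => τ ≤ (#{l ∈ L1 | inc q l} : ℝ) := ⟨_, rfl⟩
  rw [← hP1] at hrich2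
  have hP1P0 : P1 ⊆ P0 := by rw [hP1]; exact filter_subset _ _
  have hflag : N ^ 3 / (4 * K) ≤ ∑ q ∈ P1, (#{l ∈ L1 | inc q l} : ℝ) := by
    have e1 : N ^ 2 * τ = N ^ 3 / K / 8 := by rw [hτ]; field_simp
    have e2 : N ^ 3 / (4 * K) = N ^ 3 / K / 4 := by field_simp
    have e3 : N ^ 3 / (2 * K) = N ^ 3 / K / 2 := by field_simp
    rw [e1] at hrich hrich2
    rw [e3] at hI0
    rw [e2]
    linarith
  obtain ⟨W, hW⟩ : ∃ W : Q → M → Q × Q → Prop, W = fun q l e => e.1 ≠ q ∧ e.2 ≠ q ∧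
      ∃ l1 ∈ L1, ∃ l2 ∈ L1, l1 ≠ l2 ∧ l2 ≠ l ∧
      inc q l1 ∧ inc e.1 l1 ∧ inc q l2 ∧ inc e.2 l2 := ⟨_, rfl⟩
  have hWc : ∀ q ∈ P1, ∀ l, τ ^ 4 / 16 ≤ #{e ∈ P0 ×ˢ P0 | W q l e} := by
    intro q hq l
    have := pairs_card P0 L1 inc
      (fun q hq q' hq' h l hl l' hl' => hone q (hP0P hq) q' (hP0P hq') h l (hL1L hl) l' (hL1L hl'))
      τ hτ2 (fun l hl => by rw [hL1] at hl; exact (mem_filter.1 hl).2) q (hP1P0 hq)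
      (by rw [hP1] at hq; exact (mem_filter.1 hq).2) l
    rw [hW]
    convert this
  obtain ⟨Fl, hFl⟩ : ∃ Fl, Fl = (P1 ×ˢ L1).filter fun f => inc f.1 f.2 := ⟨_, rfl⟩
  have hFlc : (#Fl : ℝ) = ∑ q ∈ P1, (#{l ∈ L1 | inc q l} : ℝ) := by
    rw [hFl, card_filter, sum_product]
    push_cast
    refine sum_congr rfl fun q _ => ?_
    rw [card_filter]; push_cast; rfl
  have htot : N ^ 4 * (N ^ 3 / (8 ^ 6 * K ^ 5)) ≤
      ∑ e ∈ P0 ×ˢ P0, (#{f ∈ Fl | W f.1 f.2 e} : ℝ) := by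
    rw [← dcount Fl (P0 ×ˢ P0) fun f e => W f.1 f.2 e]
    have h1 : (#Fl : ℝ) * (τ ^ 4 / 16) ≤ ∑ f ∈ Fl, (#{e ∈ P0 ×ˢ P0 | W f.1 f.2 e} : ℝ) := by
      rw [← nsmul_eq_mul]
      refine card_nsmul_le_sum _ _ _ fun f hf => hWc f.1 ?_ f.2
      rw [hFl] at hf
      exact (mem_product.1 (mem_filter.1 hf).1).1
    refine le_trans ?_ h1
    rw [hFlc]
    calc N ^ 4 * (N ^ 3 / (8 ^ 6 * K ^ 5)) = (N ^ 3 / (4 * K)) * (τ ^ 4 / 16) := by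
          rw [hτ]; field_simp; norm_num
      _ ≤ _ := mul_le_mul_of_nonneg_right hflag (by positivity)
  have hcc : (#(P0 ×ˢ P0) : ℝ) ≤ N ^ 4 := by
    rw [card_product, Nat.cast_mul]
    calc (#P0 : ℝ) * #P0 ≤ N ^ 2 * N ^ 2 :=
          mul_le_mul hP0c hP0c (Nat.cast_nonneg _) (by positivity)
      _ = _ := by ring
  have hpos : 0 < N ^ 3 / (8 ^ 6 * K ^ 5) := by positivity
  obtain ⟨⟨p1, p2⟩, he, hE⟩ : ∃ e ∈ P0 ×ˢ P0, N ^ 3 / (8 ^ 6 * K ^ 5) ≤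
      (#{f ∈ Fl | W f.1 f.2 e} : ℝ) := by
    by_contra! hcon
    have hne : (P0 ×ˢ P0).Nonempty := by
      by_contra hemp
      rw [not_nonempty_iff_eq_empty] at hemp
      rw [hemp, sum_empty] at htot
      have : 0 < N ^ 4 * (N ^ 3 / (8 ^ 6 * K ^ 5)) := by positivity
      linarith
    have h1 := sum_lt_sum_of_nonempty hne hcon
    rw [sum_const, nsmul_eq_mul] at h1
    have := mul_le_mul_of_nonneg_right hcc hpos.le
    linarith
  obtain ⟨h1, h2⟩ := mem_product.1 he
  refine ⟨p1, hP0P h1, p2, hP0P h2, ?_, ?_, ?_⟩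
  · rw [hP0] at h1; exact (mem_filter.1 h1).2
  · rw [hP0] at h2; exact (mem_filter.1 h2).2
  · refine hE.trans (Nat.cast_le.2 (card_le_card ?_))
    intro f hf
    rw [hFl, hW] at hf
    simp only [mem_filter, mem_product] at hf ⊢
    obtain ⟨⟨⟨a1, a2⟩, a3⟩, a4, a5, l1, c1, l2, c2, a6⟩ := hf
    exact ⟨⟨hP0P (hP1P0 a1), hL1L a2⟩, a3, a4, a5, l1, hL1L c1, l2, hL1L c2, a6⟩

theorem line_ker {F : Type*} [Field F] (l : Submodule F (Fin 3 → F))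
    (hl : Module.finrank F l = 2) :
    ∃ f : (Fin 3 → F) →ₗ[F] F, f ≠ 0 ∧ l = LinearMap.ker f := by
  have hlt : l < ⊤ := by
    rw [lt_top_iff_ne_top]
    rintro rfl
    rw [finrank_top, Module.finrank_fin_fun] at hl
    omega
  obtain ⟨f, hf, hle⟩ := Submodule.exists_le_ker_of_lt_top l hlt
  refine ⟨f, hf, Submodule.eq_of_le_of_finrank_eq hle ?_⟩
  have := Module.Dual.finrank_ker_add_one_of_ne_zero hf
  rw [Module.finrank_fin_fun] at this
  omega

theorem pt_span {F : Type*} [Field F] (q : Submodule F (Fin 3 → F))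
    (hq : Module.finrank F q = 1) : ∃ w, w ≠ 0 ∧ q = Submodule.span F {w} := by
  obtain ⟨⟨v, hv⟩, hne, h⟩ := finrank_eq_one_iff'.1 hq
  refine ⟨v, fun h0 => hne (by ext1; exact h0), le_antisymm ?_ ?_⟩
  · intro x hx
    obtain ⟨c, hc⟩ := h ⟨x, hx⟩
    rw [Submodule.mem_span_singleton]
    exact ⟨c, congrArg Subtype.val hc⟩
  · rw [Submodule.span_singleton_le_iff_mem]; exact hv

theorem pair_line {F : Type*} [Field F] (v1 v2 : Fin 3 → F)
    (h2 : v2 ≠ 0) (h : v1 ∉ Submodule.span F {v2}) :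
    Module.finrank F (Submodule.span F {v1, v2}) = 2 := by
  have hli : LinearIndependent F ![v1, v2] := by
    rw [LinearIndependent.pair_iff]
    intro s t hst
    by_cases hs : s = 0
    · subst hs
      rw [zero_smul, zero_add] at hst
      exact ⟨rfl, (smul_eq_zero.1 hst).resolve_right h2⟩
    · exfalso
      apply h
      rw [Submodule.mem_span_singleton]
      refine ⟨-(s⁻¹ * t), ?_⟩
      have : v1 = s⁻¹ • (s • v1) := by rw [smul_smul, inv_mul_cancel₀ hs, one_smul]
      rw [this, eq_neg_of_add_eq_zero_left hst, smul_neg, smul_smul, neg_smul]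
  have := finrank_span_eq_card hli
  rwa [Matrix.range_cons_cons_empty, Fintype.card_fin] at this

theorem two_pts {F : Type*} [Field F] (q q' l l' : Submodule F (Fin 3 → F))
    (hq : Module.finrank F q = 1) (hq' : Module.finrank F q' = 1)
    (hl : Module.finrank F l = 2) (hl' : Module.finrank F l' = 2) (hne : q ≠ q')
    (h1 : q ≤ l) (h2 : q' ≤ l) (h3 : q ≤ l') (h4 : q' ≤ l') : l = l' := by
  obtain ⟨v, hv, rfl⟩ := pt_span q hq
  obtain ⟨v', hv', rfl⟩ := pt_span q' hq'
  have hni : v ∉ Submodule.span F {v'} := by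
    intro h
    apply hne
    refine Submodule.eq_of_le_of_finrank_eq ?_ (hq.trans hq'.symm)
    rwa [Submodule.span_singleton_le_iff_mem]
  have h := pair_line v v' hv' hni
  rw [Submodule.span_singleton_le_iff_mem] at h1 h2 h3 h4
  have e1 : Submodule.span F {v, v'} = l := by
    refine Submodule.eq_of_le_of_finrank_eq ?_ (h.trans hl.symm)
    rw [Submodule.span_le]
    rintro x (rfl | rfl) <;> assumption
  have e2 : Submodule.span F {v, v'} = l' := by
    refine Submodule.eq_of_le_of_finrank_eq ?_ (h.trans hl'.symm)
    rw [Submodule.span_le]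
    rintro x (rfl | rfl) <;> assumption
  rw [← e1, e2]

open Classical in
theorem geom {F : Type*} [Field F] (P L : Finset (Submodule F (Fin 3 → F)))
    (hP : ∀ q ∈ P, Module.finrank F q = 1) (hL : ∀ l ∈ L, Module.finrank F l = 2)
    (p1 p2 : Submodule F (Fin 3 → F)) (hp1 : p1 ∈ P) (hp2 : p2 ∈ P)
    (T : Finset (Submodule F (Fin 3 → F) × Submodule F (Fin 3 → F)))
    (hT : ∀ f ∈ T, f.1 ∈ P ∧ f.2 ∈ L ∧ f.1 ≤ f.2 ∧ p1 ≠ f.1 ∧ p2 ≠ f.1 ∧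
        ∃ l1 ∈ L, ∃ l2 ∈ L, l1 ≠ l2 ∧ l2 ≠ f.2 ∧
        f.1 ≤ l1 ∧ p1 ≤ l1 ∧ f.1 ≤ l2 ∧ p2 ≤ l2) (hTn : T.Nonempty) :
    ∃ (A B : Finset F) (Λ : Finset (F × F)), #A ≤ #{l ∈ L | p1 ≤ l} ∧ #B ≤ #{l ∈ L | p2 ≤ l} ∧
      #Λ ≤ #L ∧ #T ≤ ∑ l ∈ Λ, #{b ∈ B | l.1 * b + l.2 ∈ A} := by
  have hne : p1 ≠ p2 := by
    rintro rfl
    obtain ⟨f, hf⟩ := hTn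
    obtain ⟨a1, a2, a3, a4, a5, l1, b1, l2, b2, b3, b4, b5, b6, b7, b8⟩ := hT f hf
    exact b3 (two_pts p1 f.1 l1 l2 (hP _ hp1) (hP _ a1) (hL _ b1) (hL _ b2) a4 b6 b5 b8 b7)
  obtain ⟨v1, hv1, hv1'⟩ := pt_span p1 (hP _ hp1)
  obtain ⟨v2, hv2, hv2'⟩ := pt_span p2 (hP _ hp2)
  have hni : v1 ∉ Submodule.span F {v2} := by
    intro h
    apply hne
    refine Submodule.eq_of_le_of_finrank_eq ?_ ((hP _ hp1).trans (hP _ hp2).symm)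
    rw [hv1', hv2']
    rwa [Submodule.span_singleton_le_iff_mem]
  obtain ⟨g, hg, hgk⟩ := line_ker _ (pair_line v1 v2 hv2 hni)
  obtain ⟨v3, hv3⟩ : ∃ v3, g v3 = 1 := LinearMap.surjective hg 1
  have hdec : ∀ w, ∃ a b : F, w = a • v1 + b • v2 + g w • v3 := by
    intro w
    have : w - g w • v3 ∈ Submodule.span F {v1, v2} := by
      rw [hgk, LinearMap.mem_ker, map_sub, map_smul, hv3, smul_eq_mul, mul_one, sub_self]
    obtain ⟨a, b, h⟩ := Submodule.mem_span_pair.1 this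
    exact ⟨a, b, by rw [h]; abel⟩
  have hp1l : ∀ f : (Fin 3 → F) →ₗ[F] F, p1 ≤ LinearMap.ker f ↔ f v1 = 0 := by
    intro f; rw [hv1', Submodule.span_singleton_le_iff_mem, LinearMap.mem_ker]
  have hp2l : ∀ f : (Fin 3 → F) →ₗ[F] F, p2 ≤ LinearMap.ker f ↔ f v2 = 0 := by
    intro f; rw [hv2', Submodule.span_singleton_le_iff_mem, LinearMap.mem_ker]
  have hfun : ∀ l, ∃ f : (Fin 3 → F) →ₗ[F] F, l ∈ L → l = LinearMap.ker f := by
    intro l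
    by_cases hl : l ∈ L
    · obtain ⟨f, -, hf⟩ := line_ker l (hL l hl)
      exact ⟨f, fun _ => hf⟩
    · exact ⟨0, fun h => absurd h hl⟩
  choose φ hφ using hfun
  -- structure of flags
  have hflag : ∀ f ∈ T, ∃ x y : F, f.1 = Submodule.span F {y • v1 + x • v2 + v3} ∧
      φ f.2 v2 ≠ 0 ∧ y * φ f.2 v1 + x * φ f.2 v2 + φ f.2 v3 = 0 ∧
      (∃ l1 ∈ L, p1 ≤ l1 ∧ x = - φ l1 v3 / φ l1 v2) ∧
      (∃ l2 ∈ L, p2 ≤ l2 ∧ y = - φ l2 v3 / φ l2 v1) := by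
    intro f hf
    obtain ⟨a1, a2, a3, a4, a5, l1, b1, l2, b2, b3, b4, b5, b6, b7, b8⟩ := hT f hf
    have c1 : φ l1 v1 = 0 := by rw [← hp1l, ← hφ l1 b1]; exact b6
    have c2 : φ l2 v2 = 0 := by rw [← hp2l, ← hφ l2 b2]; exact b8
    have c3 : φ l1 v2 ≠ 0 := by
      rw [Ne, ← hp2l, ← hφ l1 b1]
      intro h
      exact b3 (two_pts p2 f.1 l1 l2 (hP _ hp2) (hP _ a1) (hL _ b1) (hL _ b2) a5 h b5 b8 b7)
    have c4 : φ l2 v1 ≠ 0 := by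
      rw [Ne, ← hp1l, ← hφ l2 b2]
      intro h
      exact b3 (two_pts p1 f.1 l1 l2 (hP _ hp1) (hP _ a1) (hL _ b1) (hL _ b2) a4 b6 b5 h b7)
    have c5 : φ f.2 v2 ≠ 0 := by
      rw [Ne, ← hp2l, ← hφ f.2 a2]
      intro h
      exact b4 (two_pts p2 f.1 l2 f.2 (hP _ hp2) (hP _ a1) (hL _ b2) (hL _ a2) a5 b8 b7 h a3)
    obtain ⟨w, hw, hw'⟩ := pt_span f.1 (hP _ a1)
    have hmem : ∀ l ∈ L, f.1 ≤ l → φ l w = 0 := by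
      intro l hl h
      rw [hw', Submodule.span_singleton_le_iff_mem, hφ l hl, LinearMap.mem_ker] at h
      exact h
    obtain ⟨a, b, hab⟩ := hdec w
    have hgw : g w ≠ 0 := by
      intro h0
      rw [h0, zero_smul, add_zero] at hab
      have d1 := hmem l1 b1 b5
      have d2 := hmem l2 b2 b7
      rw [hab, map_add, map_smul, map_smul, smul_eq_mul, smul_eq_mul] at d1 d2
      rw [c1, mul_zero, zero_add] at d1
      rw [c2, mul_zero, add_zero] at d2
      have hb0 := (mul_eq_zero.1 d1).resolve_right c3
      have ha0 := (mul_eq_zero.1 d2).resolve_right c4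
      rw [hb0, ha0, zero_smul, zero_smul, add_zero] at hab
      exact hw hab
    obtain ⟨z, hz⟩ : ∃ z, z = g w := ⟨_, rfl⟩
    rw [← hz] at hgw hab
    have hrel : ∀ l ∈ L, f.1 ≤ l →
        (z⁻¹ * a) * φ l v1 + (z⁻¹ * b) * φ l v2 + φ l v3 = 0 := by
      intro l hl h
      have := hmem l hl h
      rw [hab, map_add, map_add, map_smul, map_smul, map_smul] at this
      simp only [smul_eq_mul] at this
      field_simp
      linear_combination this
    have d1 := hrel l1 b1 b5
    have d2 := hrel l2 b2 b7
    refine ⟨z⁻¹ * b, z⁻¹ * a, ?_, c5, hrel _ a2 a3, ⟨l1, b1, b6, ?_⟩, ⟨l2, b2, b8, ?_⟩⟩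
    · have e : (z⁻¹ * a) • v1 + (z⁻¹ * b) • v2 + v3 = z⁻¹ • w := by
        rw [hab, smul_add, smul_add, smul_smul, smul_smul, smul_smul, inv_mul_cancel₀ hgw, one_smul]
      rw [e, hw']
      exact (Submodule.span_singleton_smul_eq (inv_ne_zero hgw).isUnit w).symm
    · rw [eq_div_iff c3]
      rw [c1] at d1
      linear_combination d1
    · rw [eq_div_iff c4]
      rw [c2] at d2
      linear_combination d2
  have hflag' : ∀ f, ∃ x y : F, f ∈ T → f.1 = Submodule.span F {y • v1 + x • v2 + v3} ∧
      φ f.2 v2 ≠ 0 ∧ y * φ f.2 v1 + x * φ f.2 v2 + φ f.2 v3 = 0 ∧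
      (∃ l1 ∈ L, p1 ≤ l1 ∧ x = - φ l1 v3 / φ l1 v2) ∧
      (∃ l2 ∈ L, p2 ≤ l2 ∧ y = - φ l2 v3 / φ l2 v1) := by
    intro f
    by_cases hf : f ∈ T
    · obtain ⟨x, y, h⟩ := hflag f hf
      exact ⟨x, y, fun _ => h⟩
    · exact ⟨0, 0, fun h => absurd h hf⟩
  choose x y hxy using hflag'
  refine ⟨({l ∈ L | p1 ≤ l}).image fun l => - φ l v3 / φ l v2,
    ({l ∈ L | p2 ≤ l}).image fun l => - φ l v3 / φ l v1,
    L.image fun l => (- φ l v1 / φ l v2, - φ l v3 / φ l v2),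
    card_image_le, card_image_le, card_image_le, ?_⟩
  rw [← card_sigma]
  refine card_le_card_of_injOn
    (fun f => ⟨(- φ f.2 v1 / φ f.2 v2, - φ f.2 v3 / φ f.2 v2), y f⟩) ?_ ?_
  · intro f hf
    obtain ⟨h1, h2, h3, ⟨l1, h4, h5, h6⟩, ⟨l2, h7, h8, h9⟩⟩ := hxy f hf
    rw [mem_coe, mem_sigma, mem_filter]
    refine ⟨mem_image_of_mem _ (hT f hf).2.1, mem_image.2 ⟨l2, mem_filter.2 ⟨h7, h8⟩, h9.symm⟩,
      mem_image.2 ⟨l1, mem_filter.2 ⟨h4, h5⟩, ?_⟩⟩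
    rw [← h6]
    dsimp only
    field_simp
    linear_combination h3
  · intro f hf f' hf' h
    obtain ⟨h1, h2, h3, -⟩ := hxy f hf
    obtain ⟨h1', h2', h3', -⟩ := hxy f' hf'
    simp only [Sigma.mk.injEq, Prod.mk.injEq, heq_eq_eq] at h
    obtain ⟨⟨e1, e2⟩, e3⟩ := h
    have ex : x f = x f' := by
      have k1 : x f = (- φ f.2 v1 / φ f.2 v2) * y f + (- φ f.2 v3 / φ f.2 v2) := by
        field_simp
        linear_combination h3
      have k2 : x f' = (- φ f'.2 v1 / φ f'.2 v2) * y f' + (- φ f'.2 v3 / φ f'.2 v2) := by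
        field_simp
        linear_combination h3'
      rw [k1, k2, e1, e2, e3]
    have q1 : f.1 = f'.1 := by rw [h1, h1', ex, e3]
    rw [div_eq_div_iff h2 h2'] at e1 e2
    have q2 : f.2 = f'.2 := by
      refine Submodule.eq_of_le_of_finrank_eq ?_
        ((hL _ (hT f hf).2.1).trans (hL _ (hT f' hf').2.1).symm)
      intro u hu
      rw [hφ _ (hT f hf).2.1, LinearMap.mem_ker] at hu
      rw [hφ _ (hT f' hf').2.1, LinearMap.mem_ker]
      obtain ⟨a, b, hab⟩ := hdec u
      rw [hab, map_add, map_add, map_smul, map_smul, map_smul] at hu ⊢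
      simp only [smul_eq_mul] at hu ⊢
      refine (mul_eq_zero.1 (?_ : φ f.2 v2 * _ = 0)).resolve_left h2
      linear_combination φ f'.2 v2 * hu + a * e1 + g u * e2
    exact Prod.ext q1 q2

open Classical in
theorem main_ineq (p : ℕ) [Fact p.Prime] (P L : Finset (Submodule (ZMod p) (Fin 3 → ZMod p)))
    (hP : ∀ q ∈ P, Module.finrank (ZMod p) q = 1) (hL : ∀ l ∈ L, Module.finrank (ZMod p) l = 2)
    (N K D : ℝ) (hD : D = 2 ^ 74) (hN : 0 < N) (hK : 1 ≤ K) (hPc : (#P : ℝ) ≤ N ^ 2)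
    (hLc : (#L : ℝ) ≤ N ^ 2) (hp : N ^ 2 ≤ p)
    (hI : N ^ 3 / K ≤ ∑ q ∈ P, (#{l ∈ L | q ≤ l} : ℝ)) :
    N ≤ (2 ^ 21 * D ^ 195 + 8 ^ 7 + 16) * K ^ 3900 := by
  have hD0 : 0 < D := by rw [hD]; positivity
  have hK0 : 0 < K := by linarith
  have hK1 : 1 ≤ K ^ 3900 := one_le_pow₀ hK
  have hK2 : K ≤ K ^ 3900 := le_self_pow₀ hK (by norm_num)
  have hK5 : K ^ 5 ≤ K ^ 3900 := pow_le_pow_right₀ hK (by norm_num)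
  obtain ⟨k, hk⟩ : ∃ k, k = K ^ 3900 := ⟨_, rfl⟩
  have hDD : 0 ≤ 2 ^ 21 * D ^ 195 * k := by rw [hk]; positivity
  rw [← hk] at hK1 hK2 hK5 ⊢
  by_cases hNK : 16 * K ≤ N
  swap
  · push Not at hNK
    linarith
  obtain ⟨ρ, hρ⟩ : ∃ ρ, ρ = N / (2 * 8 ^ 6 * K ^ 5) := ⟨_, rfl⟩
  by_cases hρ4 : 4 ≤ ρ
  swap
  · push Not at hρ4
    rw [hρ, div_lt_iff₀ (by positivity)] at hρ4
    linarith
  obtain ⟨p1, hp1, p2, hp2, hd1, hd2, hT⟩ := abstract_inc P L (fun q l => q ≤ l)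
    (fun q hq q' hq' hne l hl l' hl' h1 h2 h3 h4 => two_pts q q' l l' (hP q hq) (hP q' hq')
      (hL l hl) (hL l' hl') hne h1 h2 h3 h4) N K hK0 hNK hPc hLc hI
  have hpos : 0 < N ^ 3 / (8 ^ 6 * K ^ 5) := by positivity
  obtain ⟨A, B, Λ, hA, hB, hΛ, hJ⟩ := geom P L hP hL p1 p2 hp1 hp2 _ (by
    intro f hf
    rw [mem_filter, mem_product] at hf
    exact ⟨hf.1.1, hf.1.2, hf.2⟩) (card_pos.1 (Nat.cast_pos.1 (hpos.trans_le hT)))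
  have hJr : N ^ 3 / (8 ^ 6 * K ^ 5) ≤ ∑ l ∈ Λ, (#{b ∈ B | l.1 * b + l.2 ∈ A} : ℝ) := by
    refine hT.trans ?_
    rw [← Nat.cast_sum]
    refine Nat.cast_le.2 ?_
    convert hJ
  obtain ⟨J, hJd⟩ : ∃ J, J = ∑ l ∈ Λ, (#{b ∈ B | l.1 * b + l.2 ∈ A} : ℝ) := ⟨_, rfl⟩
  rw [← hJd] at hJr
  have hAm := (Nat.cast_le (α := ℝ).2 hA).trans hd1
  have hBm := (Nat.cast_le (α := ℝ).2 hB).trans hd2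
  have hΛm := (Nat.cast_le (α := ℝ).2 hΛ).trans hLc
  have hfin := affine p A B Λ (4 * K * N) ρ (16 / (D * K ^ 20)) (by positivity) (by positivity)
    (by
      rw [div_le_iff₀ (by positivity)]
      have h1 : 1 ≤ K ^ 20 := one_le_pow₀ hK
      have h2 : 1 ≤ D := by rw [hD]; norm_num
      have := one_le_mul_of_one_le_of_one_le h2 h1
      linarith)
    hAm hBm hρ4
    (by
      convert le_trans (b := N ^ 3 / (8 ^ 6 * K ^ 5)) ?_ (hJr.trans hJd.le)
      calc 2 * ρ * #Λ ≤ 2 * ρ * N ^ 2 := mul_le_mul_of_nonneg_left hΛm (by linarith)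
        _ = _ := by rw [hρ]; field_simp)
    (by
      have : 16 * (16 / (D * K ^ 20)) * (4 * K * N) ^ 5 ≤ J * ρ ^ 2 := by
        calc 16 * (16 / (D * K ^ 20)) * (4 * K * N) ^ 5 = N ^ 3 / (8 ^ 6 * K ^ 5) * ρ ^ 2 := by
              rw [hρ, hD]; field_simp; norm_num
          _ ≤ _ := mul_le_mul_of_nonneg_right hJr (by positivity)
      rw [hJd] at this
      convert this)
    (by
      refine le_trans ?_ hp
      have e : 16 / (D * K ^ 20) / 16 * (4 * K * N) ^ 2 = N ^ 2 * (16 / (D * K ^ 18)) := by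
        field_simp; norm_num
      rw [e]
      refine mul_le_of_le_one_right (by positivity) ?_
      rw [div_le_one (by positivity)]
      have h1 : 1 ≤ K ^ 18 := one_le_pow₀ hK
      have h2 : 16 ≤ D := by rw [hD]; norm_num
      calc (16 : ℝ) = 16 * 1 := by norm_num
        _ ≤ _ := mul_le_mul h2 h1 (by norm_num) hD0.le)
  have e1 : 16 / (D * K ^ 20) / 16 = (D * K ^ 20)⁻¹ := by field_simp
  rw [e1, inv_pow, inv_mul_le_iff₀ (by positivity), mul_pow, ← pow_mul] at hfin
  have e2 : K ^ (20 * 195) = k := by rw [hk]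
  rw [e2] at hfin
  have : N ≤ 4 * K * N := by nlinarith
  have e3 : D ^ 195 * k * 2 ^ 21 = 2 ^ 21 * D ^ 195 * k := by ring
  rw [e3] at hfin
  linarith

open Classical in
theorem finset_version : ∃ C : ℝ, 1 ≤ C ∧ ∀ (p : ℕ) [Fact p.Prime] (n : ℕ)
    (P L : Finset (Submodule (ZMod p) (Fin 3 → ZMod p))),
    (∀ q ∈ P, Module.finrank (ZMod p) q = 1) → (∀ l ∈ L, Module.finrank (ZMod p) l = 2) →
    #P = n → #L = n → n < p → 0 < n →
    ∑ q ∈ P, (#{l ∈ L | q ≤ l} : ℝ) ≤ C * (n : ℝ) ^ ((3 : ℝ) / 2 - 1 / 10678) := by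
  obtain ⟨D, hD⟩ : ∃ D : ℝ, D = 2 ^ 74 := ⟨_, rfl⟩
  have hD0 : 0 < D := by rw [hD]; positivity
  obtain ⟨C, hC⟩ : ∃ C : ℝ, C = 2 ^ 21 * D ^ 195 + 8 ^ 7 + 16 := ⟨_, rfl⟩
  have hC1 : 1 ≤ C := by
    have : 0 ≤ 2 ^ 21 * D ^ 195 := by positivity
    rw [hC]; linarith
  refine ⟨C ^ 21356, one_le_pow₀ hC1, ?_⟩
  intro p _ n P L hP hL hPn hLn hnp hn
  have hn1 : (1 : ℝ) ≤ n := by exact_mod_cast hn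
  obtain ⟨k, hk⟩ : ∃ k : ℝ, k = (n : ℝ) ^ ((1 : ℝ) / 10678) := ⟨_, rfl⟩
  have hk1 : 1 ≤ k := by rw [hk]; exact Real.one_le_rpow hn1 (by norm_num)
  have hkn : k ^ 10678 = n := by
    rw [hk, ← Real.rpow_natCast, ← Real.rpow_mul (by positivity)]
    norm_num
  have hke : (n : ℝ) ^ ((3 : ℝ) / 2 - 1 / 10678) = k ^ 16016 := by
    rw [hk, ← Real.rpow_natCast, ← Real.rpow_mul (by positivity)]
    norm_num
  have hN2 : (k ^ 5339) ^ 2 = n := by rw [← pow_mul, ← hkn]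
  have hk0 : 0 < k := by linarith
  have hC0 : 0 < C := by linarith
  rw [hke]
  by_cases hI : k ^ 16016 ≤ ∑ q ∈ P, (#{l ∈ L | q ≤ l} : ℝ)
  swap
  · push Not at hI
    refine hI.le.trans ?_
    exact le_mul_of_one_le_left (pow_nonneg hk0.le _) (one_le_pow₀ hC1)
  have hdiv : (k ^ 5339) ^ 3 / k = k ^ 16016 := by
    rw [div_eq_iff hk0.ne', ← pow_mul, ← pow_succ]
  have h := main_ineq p P L hP hL (k ^ 5339) k D hD (pow_pos hk0 _) hk1
    (by rw [hN2, hPn]) (by rw [hN2, hLn]) (by rw [hN2]; exact_mod_cast hnp.le)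
    (by rw [hdiv]; exact hI)
  rw [← hC] at h
  have h2 : k ^ 1439 ≤ C := by
    have e : k ^ 5339 = k ^ 1439 * k ^ 3900 := by rw [← pow_add]
    rw [e] at h
    exact le_of_mul_le_mul_right h (pow_pos hk0 _)
  have h3 : k ≤ C := (le_self_pow₀ hk1 (by norm_num)).trans h2
  have h4 : k ^ 21356 ≤ C ^ 21356 := pow_le_pow_left₀ hk0.le h3 _
  have h5 : ∑ q ∈ P, (#{l ∈ L | q ≤ l} : ℝ) ≤ k ^ 21356 := by
    have h6 : ∀ q ∈ P, (#{l ∈ L | q ≤ l} : ℝ) ≤ n := fun q _ =>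
      card_le_of (filter_subset _ _) (by rw [hLn])
    refine (sum_le_card_nsmul _ _ _ h6).trans ?_
    rw [nsmul_eq_mul, hPn, ← hkn, ← pow_add]
  refine (h5.trans h4).trans ?_
  exact le_mul_of_one_le_right (pow_nonneg hC0.le _) (one_le_pow₀ hk1)

end Helpers

theorem stmt_2 :
    ∃ C : ℝ, ∀ (p : ℕ) [Fact p.Prime] (n : ℕ)
      (P L : Set (Submodule (ZMod p) (Fin 3 → ZMod p))),
      (∀ q ∈ P, Module.finrank (ZMod p) ↥q = 1) →
      (∀ l ∈ L, Module.finrank (ZMod p) ↥l = 2) →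
      P.Finite → L.Finite → P.ncard = n → L.ncard = n → n < p →
      (({ql : Submodule (ZMod p) (Fin 3 → ZMod p) × Submodule (ZMod p) (Fin 3 → ZMod p) |
          ql.1 ∈ P ∧ ql.2 ∈ L ∧ ql.1 ≤ ql.2}.ncard : ℝ))
        ≤ C * (n : ℝ) ^ ((3 : ℝ) / 2 - 1 / 10678) := by
  classical
  obtain ⟨C, hC1, hC⟩ := finset_version
  refine ⟨C, ?_⟩
  intro p _ n P L hP hL hPf hLf hPn hLn hnp
  obtain ⟨P, rfl⟩ := hPf.exists_finset_coe
  obtain ⟨L, rfl⟩ := hLf.exists_finset_coe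
  rw [Set.ncard_coe_finset] at hPn hLn
  have hset : {ql : Submodule (ZMod p) (Fin 3 → ZMod p) × Submodule (ZMod p) (Fin 3 → ZMod p) |
      ql.1 ∈ (P : Set (Submodule (ZMod p) (Fin 3 → ZMod p))) ∧
      ql.2 ∈ (L : Set (Submodule (ZMod p) (Fin 3 → ZMod p))) ∧ ql.1 ≤ ql.2} =
      (((P ×ˢ L).filter fun f => f.1 ≤ f.2 : Finset _) :
        Set (Submodule (ZMod p) (Fin 3 → ZMod p) × Submodule (ZMod p) (Fin 3 → ZMod p))) := by
    ext f
    simp [and_assoc]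
  rw [hset, Set.ncard_coe_finset]
  have hcard : (((P ×ˢ L).filter fun f => f.1 ≤ f.2).card : ℝ) =
      ∑ q ∈ P, ((L.filter fun l => q ≤ l).card : ℝ) := by
    rw [Finset.card_filter, Finset.sum_product]
    push_cast
    refine Finset.sum_congr rfl fun q _ => ?_
    rw [Finset.card_filter]; push_cast; rfl
  rw [hcard]
  rcases Nat.eq_zero_or_pos n with h0 | h0
  · have : P = ∅ := Finset.card_eq_zero.1 (hPn.trans h0)
    rw [this, Finset.sum_empty]
    exact mul_nonneg (by linarith) (Real.rpow_nonneg (Nat.cast_nonneg _) _)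
  · convert hC p n P L (fun q hq => hP q hq) (fun l hl => hL l hl) hPn hLn hnp h0
end

section
/- (Plünnecke–Ruzsa inequality, Ruzsa's form.) Let Y, X₁, …, X_k be finite nonempty subsets of an abelian group. Then there exists a nonempty subset Y' ⊆ Y such that |Y' + X₁ + ⋯ + X_k| ≤ (∏_{i=1}^k |Y + X_i| / |Y|^(k−1)) · |Y'|. -/
open Pointwise

theorem aux_mem_sum {G ι : Type*} [AddCommGroup G] [DecidableEq G] [Fintype ι]
    (X : ι → Finset G) (x : G) :
    x ∈ ∑ i, X i ↔ ∃ g : ι → G, (∀ i, g i ∈ X i) ∧ ∑ i, g i = x := by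
  rw [← Finset.mem_coe, Finset.coe_sum, Set.mem_fintype_sum]
  simp

theorem aux_rough {G : Type*} [AddCommGroup G] [DecidableEq G] (k : ℕ)
    (Y : Finset G) (X : Fin k → Finset G)
    (hY : Y.Nonempty) (hX : ∀ i, (X i).Nonempty) :
    (∑ i, X i).card * Y.card ^ k ≤ k ^ k * ((∏ i, (Y + X i).card) * Y.card) := by
  classical
  set m : Fin k → ℕ := fun i => (Y + X i).card with hm
  have hmpos : ∀ i, 0 < m i := fun i => (hY.add (hX i)).card_pos
  set n : Fin k → ℕ := fun i => ∏ j ∈ Finset.univ.erase i, m j with hn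
  have hnpos : ∀ i, 0 < n i := fun i => Finset.prod_pos fun j _ => hmpos j
  set M : ℕ := ∏ j, m j with hM
  have hmn : ∀ i, m i * n i = M := fun i =>
    Finset.mul_prod_erase Finset.univ m (Finset.mem_univ i)
  let T : Fin k → Finset (Fin k → ℤ) := fun i =>
    (Finset.Ico (0 : ℤ) (n i)).image (fun z => (Pi.single i z : Fin k → ℤ))
  have hT : ∀ i, (T i).card ≤ n i := fun i => by
    refine Finset.card_image_le.trans ?_
    simp
  let A : Finset (G × (Fin k → ℤ)) := Y ×ˢ {0}
  have hAc : A.card = Y.card := by simp [A]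
  have hA : A.Nonempty := by simpa [A] using hY
  let B : Finset (G × (Fin k → ℤ)) := Finset.univ.biUnion fun i => X i ×ˢ T i
  have hAB : (A + B).card ≤ k * M := by
    have hsub : A + B ⊆ Finset.univ.biUnion fun i => (Y + X i) ×ˢ T i := by
      intro p hp
      obtain ⟨a, ha, b, hb, rfl⟩ := Finset.mem_add.1 hp
      simp only [B, Finset.mem_biUnion, Finset.mem_univ, true_and, Finset.mem_product] at hb ⊢
      simp only [A, Finset.mem_product, Finset.mem_singleton] at ha
      obtain ⟨i, h1, h2⟩ := hb
      refine ⟨i, Finset.add_mem_add ha.1 h1, ?_⟩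
      simpa [ha.2] using h2
    calc (A + B).card ≤ _ := Finset.card_le_card hsub
      _ ≤ ∑ i, ((Y + X i) ×ˢ T i).card := Finset.card_biUnion_le
      _ ≤ ∑ i : Fin k, M := by
        refine Finset.sum_le_sum fun i _ => ?_
        rw [Finset.card_product, ← hmn i]
        exact Nat.mul_le_mul_left _ (hT i)
      _ = k * M := by simp
  have hkB : (∑ i, X i).card * ∏ i, n i ≤ (k • B).card := by
    have : ((∑ i, X i) ×ˢ Fintype.piFinset fun i => Finset.Ico (0 : ℤ) (n i)).card
        = (∑ i, X i).card * ∏ i, n i := by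
      simp [Finset.card_product, Fintype.card_piFinset]
    rw [← this]
    refine Finset.card_le_card ?_
    have hk : k • B = ∑ i : Fin k, B := by simp
    rw [hk]
    rintro ⟨x, f⟩ hp
    rw [Finset.mem_product, aux_mem_sum, Fintype.mem_piFinset] at hp
    obtain ⟨⟨g, hg, hx⟩, hf⟩ := hp
    rw [aux_mem_sum]
    refine ⟨fun i => (g i, Pi.single i (f i)), fun i => ?_, ?_⟩
    · simp only [B, Finset.mem_biUnion, Finset.mem_univ, true_and, Finset.mem_product]
      exact ⟨i, hg i, Finset.mem_image_of_mem _ (hf i)⟩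
    · ext1
      · simpa [Prod.fst_sum] using hx
      · simpa [Prod.snd_sum] using Finset.univ_sum_single f
  have hP := Finset.pluennecke_ruzsa_inequality_nsmul_add hA B k
  have hprod : (∏ i, n i) * M = M ^ k := by
    rw [hM, ← Finset.prod_mul_distrib, ← hM]
    simp [fun i => (mul_comm (n i) (m i)).trans (hmn i)]
  have hYpos : (0 : ℚ≥0) < Y.card := by exact_mod_cast hY.card_pos
  rw [hAc, div_pow, div_mul_eq_mul_div, le_div_iff₀ (by positivity)] at hP
  have hP' : (k • B).card * Y.card ^ k ≤ (A + B).card ^ k * Y.card := by exact_mod_cast hP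
  have hN : 0 < ∏ i, n i := Finset.prod_pos fun i _ => hnpos i
  refine Nat.le_of_mul_le_mul_left ?_ hN
  calc (∏ i, n i) * ((∑ i, X i).card * Y.card ^ k)
      = ((∑ i, X i).card * ∏ i, n i) * Y.card ^ k := by ring
    _ ≤ (k • B).card * Y.card ^ k := Nat.mul_le_mul_right _ hkB
    _ ≤ (A + B).card ^ k * Y.card := hP'
    _ ≤ (k * M) ^ k * Y.card := by gcongr
    _ = k ^ k * M ^ k * Y.card := by rw [mul_pow]
    _ = (∏ i, n i) * (k ^ k * (M * Y.card)) := by rw [← hprod]; ring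

theorem aux_pi_add {G : Type*} [AddCommGroup G] [DecidableEq G] (r : ℕ) (A B : Finset G) :
    ((Fintype.piFinset fun _ : Fin r => A) + Fintype.piFinset fun _ : Fin r => B)
      = Fintype.piFinset fun _ : Fin r => A + B := by
  ext f
  simp only [Finset.mem_add, Fintype.mem_piFinset]
  constructor
  · rintro ⟨a, ha, b, hb, rfl⟩ i
    exact ⟨a i, ha i, b i, hb i, rfl⟩
  · intro h
    choose a ha b hb hab using h
    exact ⟨a, ha, b, hb, funext hab⟩

theorem aux_pi_sum {G : Type*} [AddCommGroup G] [DecidableEq G] (r k : ℕ)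
    (X : Fin k → Finset G) :
    (∑ i, Fintype.piFinset fun _ : Fin r => X i)
      = Fintype.piFinset fun _ : Fin r => ∑ i, X i := by
  ext f
  simp only [aux_mem_sum, Fintype.mem_piFinset]
  constructor
  · rintro ⟨g, hg, rfl⟩ i
    exact ⟨fun j => g j i, fun j => hg j i, by simp⟩
  · intro h
    choose g hg hs using h
    exact ⟨fun j i => g i j, fun j i => hg i j, by ext i; simpa using hs i⟩

theorem aux_sharp {G : Type*} [AddCommGroup G] [DecidableEq G] (k : ℕ)
    (Y : Finset G) (X : Fin k → Finset G)
    (hY : Y.Nonempty) (hX : ∀ i, (X i).Nonempty) :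
    (∑ i, X i).card * Y.card ^ k ≤ (∏ i, (Y + X i).card) * Y.card := by
  set x := (∑ i, X i).card * Y.card ^ k with hx
  set y := (∏ i, (Y + X i).card) * Y.card with hy
  have hypos : 0 < y := Nat.mul_pos (Finset.prod_pos fun i _ => (hY.add (hX i)).card_pos)
    hY.card_pos
  have key : ∀ r : ℕ, x ^ r ≤ k ^ k * y ^ r := by
    intro r
    have h := aux_rough k (Fintype.piFinset fun _ : Fin r => Y)
      (fun i => Fintype.piFinset fun _ : Fin r => X i)
      (by simpa using fun _ => hY) (fun i => by simpa using fun _ => hX i)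
    simp only [aux_pi_add, aux_pi_sum, Fintype.card_piFinset, Finset.prod_const,
      Finset.card_univ, Fintype.card_fin, Finset.prod_pow] at h
    rw [hx, hy, mul_pow, mul_pow, ← pow_mul, mul_comm k r, pow_mul]
    exact h
  clear_value x y
  clear hx hy
  by_contra! hlt
  have hy' : (0 : ℝ) < y := by exact_mod_cast hypos
  have h1 : (1 : ℝ) < (x : ℝ) / y := by
    rw [one_lt_div hy']
    exact_mod_cast hlt
  obtain ⟨r, hr⟩ := pow_unbounded_of_one_lt ((k : ℝ) ^ k) h1
  rw [div_pow, lt_div_iff₀ (pow_pos hy' r)] at hr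
  have := key r
  have h2 : (x : ℝ) ^ r ≤ (k : ℝ) ^ k * (y : ℝ) ^ r := by exact_mod_cast this
  linarith

theorem stmt_4 {G : Type*} [AddCommGroup G] [DecidableEq G] (k : ℕ)
    (Y : Finset G) (X : Fin k → Finset G)
    (hY : Y.Nonempty) (hX : ∀ i, (X i).Nonempty) :
    ∃ Y' ⊆ Y, Y'.Nonempty ∧
      ((Y' + ∑ i, X i).card : ℝ)
        ≤ (∏ i, ((Y + X i).card : ℝ)) / (Y.card : ℝ) ^ (k - 1) * (Y'.card : ℝ) := by
  obtain ⟨y, hy⟩ := hY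
  refine ⟨{y}, by simpa using hy, by simp, ?_⟩
  have h := aux_sharp k Y X ⟨y, hy⟩ hX
  have hpos : 0 < Y.card := Finset.card_pos.2 ⟨y, hy⟩
  have hpos' : (0 : ℝ) < Y.card := by exact_mod_cast hpos
  have hc : ({y} + ∑ i, X i).card = (∑ i, X i).card := by
    rw [Finset.singleton_add]
    exact Finset.card_image_of_injective _ (add_right_injective y)
  rw [hc, Finset.card_singleton, Nat.cast_one, mul_one, le_div_iff₀ (by positivity)]
  rcases k with _ | k
  · simp
  · rw [pow_succ, ← mul_assoc] at h
    have := Nat.le_of_mul_le_mul_right h hpos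
    exact_mod_cast this
end

section
/- (Covering lemma.) For every ε ∈ (0, 1) there exists a constant C(ε) such that the following holds. Let X₁ and X₂ be finite nonempty subsets of an abelian group. Then there exists a finite set T of group elements with |T| ≤ C(ε) · min(|X₁ + X₂|, |X₁ − X₂|) / |X₂| such that the union of the translates t + X₂ over t ∈ T contains at least (1 − ε)·|X₁| elements of X₁. -/
open Pointwise

theorem greedy_cover {G : Type*} [AddCommGroup G] [DecidableEq G] (X₂ : Finset G)
    (δ η : ℝ) (hδ : 0 < δ) (n : ℕ) :
    ∀ U : Finset G, U.card ≤ n →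
      (∀ V ⊆ U, η < (V.card : ℝ) → ∃ t : G, δ ≤ ((V ∩ ({t} + X₂)).card : ℝ)) → 0 ≤ η →
      ∃ T : Finset G, (T.card : ℝ) * δ ≤ ((U ∩ (T + X₂)).card : ℝ) ∧
        ((U \ (T + X₂)).card : ℝ) ≤ η := by
  induction n with
  | zero =>
    intro U hU _ hη
    have : U = ∅ := by simpa using hU
    subst this
    exact ⟨∅, by simp, by simpa using hη⟩
  | succ n ih =>
    intro U hU h hη
    by_cases hs : (U.card : ℝ) ≤ η
    · exact ⟨∅, by simp, by simpa using hs⟩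
    push Not at hs
    obtain ⟨t, ht⟩ := h U subset_rfl hs
    have hpos : 0 < (U ∩ ({t} + X₂)).card := by
      have : (0 : ℝ) < ((U ∩ ({t} + X₂)).card : ℝ) := lt_of_lt_of_le hδ ht
      exact_mod_cast this
    have hsplit := Finset.card_sdiff_add_card_inter U ({t} + X₂)
    obtain ⟨T, hT1, hT2⟩ := ih (U \ ({t} + X₂)) (by omega)
      (fun V hV => h V (hV.trans Finset.sdiff_subset)) hη
    have hins : insert t T + X₂ = ({t} + X₂) ∪ (T + X₂) := by
      rw [Finset.insert_eq, Finset.union_add]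
    refine ⟨insert t T, ?_, ?_⟩
    · have hc : ((insert t T).card : ℝ) ≤ T.card + 1 := by
        exact_mod_cast Finset.card_insert_le t T
      have he : U ∩ (insert t T + X₂) =
          (U ∩ ({t} + X₂)) ∪ ((U \ ({t} + X₂)) ∩ (T + X₂)) := by
        rw [hins]; ext x
        simp only [Finset.mem_inter, Finset.mem_union, Finset.mem_sdiff]
        tauto
      have hd : Disjoint (U ∩ ({t} + X₂)) ((U \ ({t} + X₂)) ∩ (T + X₂)) := by
        rw [Finset.disjoint_left]
        intro x
        simp only [Finset.mem_inter, Finset.mem_sdiff]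
        tauto
      rw [he, Finset.card_union_of_disjoint hd]
      push_cast
      nlinarith
    · have he : U \ (insert t T + X₂) = (U \ ({t} + X₂)) \ (T + X₂) := by
        rw [hins]; ext x
        simp only [Finset.mem_union, Finset.mem_sdiff]
        tauto
      rw [he]
      exact hT2

theorem popular_sub {G : Type*} [AddCommGroup G] [DecidableEq G] (U X : Finset G)
    (hU : U.Nonempty) (hX : X.Nonempty) :
    ∃ t : G, U.card * X.card ≤ (U - X).card * (U ∩ ({t} + X)).card := by
  by_contra! hcon
  have hne : (U - X).Nonempty := hU.sub hX
  have hpos := hne.card_pos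
  have h1 : (U ×ˢ X).card = ∑ t ∈ U - X, ((U ×ˢ X).filter (fun p => p.1 - p.2 = t)).card :=
    Finset.card_eq_sum_card_fiberwise (fun p hp => by
      have hp' := Finset.mem_product.1 (Finset.mem_coe.1 hp)
      exact Finset.mem_coe.2 (Finset.sub_mem_sub hp'.1 hp'.2))
  have h2 : ∀ t, ((U ×ˢ X).filter (fun p => p.1 - p.2 = t)).card ≤ (U ∩ ({t} + X)).card := by
    intro t
    apply Finset.card_le_card_of_injOn (fun p => p.1)
    · rintro ⟨a, b⟩ hp
      simp only [Finset.coe_filter, Finset.mem_product, Set.mem_ofPred_eq] at hp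
      obtain ⟨⟨ha, hb⟩, rfl⟩ := hp
      simp only [Finset.coe_inter, Set.mem_inter_iff, Finset.mem_coe]
      exact ⟨ha, Finset.mem_add.2 ⟨a - b, by simp, b, hb, by abel⟩⟩
    · rintro ⟨a, b⟩ hp ⟨c, d⟩ hq (h : a = c)
      simp only [Finset.coe_filter, Finset.mem_product, Set.mem_ofPred_eq] at hp hq
      subst h
      have : a - b = a - d := hp.2.trans hq.2.symm
      simpa using this
  have h3 : (U - X).card * (U ×ˢ X).card < (U - X).card * (U ×ˢ X).card := by
    conv_lhs => rw [h1, Finset.mul_sum]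
    rw [Finset.card_product, ← smul_eq_mul, ← Finset.sum_const]
    apply Finset.sum_lt_sum_of_nonempty hne
    intro t _
    exact lt_of_le_of_lt (Nat.mul_le_mul_left _ (h2 t)) (hcon t)
  exact lt_irrefl _ h3

theorem popular_add {G : Type*} [AddCommGroup G] [DecidableEq G] (U X : Finset G)
    (hU : U.Nonempty) (hX : X.Nonempty) :
    ∃ t : G, U.card * X.card ≤ (U + X).card * (U ∩ ({t} + X)).card := by
  by_contra! hcon
  have hE := Finset.le_card_add_mul_addEnergy U X
  have hne : (U ×ˢ X).Nonempty := hU.product hX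
  have h1 : Finset.addEnergy U X = ∑ q ∈ U ×ˢ X,
      ((((U ×ˢ U) ×ˢ X ×ˢ X).filter (fun x => x.1.1 + x.2.1 = x.1.2 + x.2.2)).filter
        (fun x => (x.1.1, x.2.2) = q)).card := by
    unfold Finset.addEnergy
    apply Finset.card_eq_sum_card_fiberwise
    rintro ⟨⟨a, b⟩, c, d⟩ hp
    simp only [Finset.coe_filter, Finset.mem_product, Set.mem_ofPred_eq] at hp
    simp only [Finset.mem_coe, Finset.mem_product]
    tauto
  have h2 : ∀ q : G × G,
      ((((U ×ˢ U) ×ˢ X ×ˢ X).filter (fun x => x.1.1 + x.2.1 = x.1.2 + x.2.2)).filter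
        (fun x => (x.1.1, x.2.2) = q)).card ≤ (U ∩ ({q.1 - q.2} + X)).card := by
    rintro ⟨u, v⟩
    apply Finset.card_le_card_of_injOn (fun x => x.1.2)
    · rintro ⟨⟨a, b⟩, c, d⟩ hp
      simp only [Finset.coe_filter, Finset.mem_filter, Finset.mem_product, Set.mem_ofPred_eq,
        Prod.mk.injEq] at hp
      obtain ⟨⟨⟨⟨ha, hb⟩, hc, hd⟩, he⟩, rfl, rfl⟩ := hp
      simp only [Finset.coe_inter, Set.mem_inter_iff, Finset.mem_coe]
      refine ⟨hb, Finset.mem_add.2 ⟨a - d, by simp, c, hc, ?_⟩⟩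
      rw [sub_add_eq_add_sub, he, add_sub_cancel_right]
    · rintro ⟨⟨a, b⟩, c, d⟩ hp ⟨⟨a', b'⟩, c', d'⟩ hq (h : b = b')
      simp only [Finset.coe_filter, Finset.mem_filter, Finset.mem_product, Set.mem_ofPred_eq,
        Prod.mk.injEq] at hp hq
      obtain ⟨⟨_, he⟩, rfl, rfl⟩ := hp
      obtain ⟨⟨_, he'⟩, rfl, rfl⟩ := hq
      subst h
      have : a' + c = a' + c' := he.trans he'.symm
      have := add_left_cancel this
      subst this
      rfl
  have h3 : (U + X).card * Finset.addEnergy U X < U.card ^ 2 * X.card ^ 2 := by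
    have hr : U.card ^ 2 * X.card ^ 2 = ∑ q ∈ U ×ˢ X, U.card * X.card := by
      rw [Finset.sum_const, Finset.card_product, smul_eq_mul]; ring
    rw [h1, Finset.mul_sum, hr]
    apply Finset.sum_lt_sum_of_nonempty hne
    intro q _
    exact lt_of_le_of_lt (Nat.mul_le_mul_left _ (h2 q)) (hcon _)
  omega

theorem cover_of_popular {G : Type*} [AddCommGroup G] [DecidableEq G] (X₁ X₂ : Finset G)
    (h₁ : X₁.Nonempty) (h₂ : X₂.Nonempty) (ε : ℝ) (hε : 0 < ε) (K : ℕ) (hK : 0 < K)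
    (h : ∀ V ⊆ X₁, V.Nonempty → ∃ t : G, V.card * X₂.card ≤ K * (V ∩ ({t} + X₂)).card) :
    ∃ T : Finset G, (T.card : ℝ) ≤ 1 / ε * (K : ℝ) / (X₂.card : ℝ) ∧
      (1 - ε) * (X₁.card : ℝ) ≤ ((X₁ ∩ (T + X₂)).card : ℝ) := by
  have p1 : (0 : ℝ) < X₁.card := by exact_mod_cast h₁.card_pos
  have p2 : (0 : ℝ) < X₂.card := by exact_mod_cast h₂.card_pos
  have pK : (0 : ℝ) < K := by exact_mod_cast hK
  obtain ⟨T, hT1, hT2⟩ := greedy_cover X₂ (ε * X₁.card * X₂.card / K) (ε * X₁.card)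
    (by positivity) X₁.card X₁ le_rfl (by
      intro V hV hlt
      have hVp : (0 : ℝ) < V.card := lt_trans (by positivity) hlt
      have hVn : V.Nonempty := Finset.card_pos.1 (by exact_mod_cast hVp)
      obtain ⟨t, ht⟩ := h V hV hVn
      refine ⟨t, ?_⟩
      have ht' : (V.card : ℝ) * X₂.card ≤ K * (V ∩ ({t} + X₂)).card := by exact_mod_cast ht
      rw [div_le_iff₀ pK]
      nlinarith) (by positivity)
  refine ⟨T, ?_, ?_⟩
  · have hle : ((X₁ ∩ (T + X₂)).card : ℝ) ≤ X₁.card := by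
      exact_mod_cast Finset.card_le_card Finset.inter_subset_left
    have h3 := hT1.trans hle
    rw [← mul_div_assoc, div_le_iff₀ pK] at h3
    have h4 : (T.card : ℝ) * (ε * X₂.card) ≤ K := by
      apply le_of_mul_le_mul_left _ p1
      linarith
    rw [le_div_iff₀ p2, one_div, inv_mul_eq_div, le_div_iff₀ hε]
    linarith
  · have hs : ((X₁ \ (T + X₂)).card : ℝ) + ((X₁ ∩ (T + X₂)).card : ℝ) = X₁.card := by
      exact_mod_cast Finset.card_sdiff_add_card_inter X₁ (T + X₂)
    linarith

theorem stmt_7 :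
    ∀ ε : ℝ, ε ∈ Set.Ioo (0 : ℝ) 1 → ∃ C : ℝ,
      ∀ (G : Type*) [AddCommGroup G] [DecidableEq G] (X₁ X₂ : Finset G),
        X₁.Nonempty → X₂.Nonempty →
        ∃ T : Finset G,
          (T.card : ℝ) ≤ C * min (((X₁ + X₂).card : ℝ)) (((X₁ - X₂).card : ℝ)) / (X₂.card : ℝ) ∧
          (1 - ε) * (X₁.card : ℝ) ≤ ((X₁ ∩ (T + X₂)).card : ℝ) := by
  intro ε hε
  refine ⟨1 / ε, ?_⟩
  intro G _ _ X₁ X₂ h₁ h₂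
  rcases min_choice (((X₁ + X₂).card : ℝ)) (((X₁ - X₂).card : ℝ)) with h | h
  · rw [h]
    apply cover_of_popular X₁ X₂ h₁ h₂ ε hε.1 _ (h₁.add h₂).card_pos
    intro V hV hVn
    obtain ⟨t, ht⟩ := popular_add V X₂ hVn h₂
    exact ⟨t, ht.trans (Nat.mul_le_mul_right _
      (Finset.card_le_card (Finset.add_subset_add_right hV)))⟩
  · rw [h]
    apply cover_of_popular X₁ X₂ h₁ h₂ ε hε.1 _ (h₁.sub h₂).card_pos
    intro V hV hVn
    obtain ⟨t, ht⟩ := popular_sub V X₂ hVn h₂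
    exact ⟨t, ht.trans (Nat.mul_le_mul_right _
      (Finset.card_le_card (Finset.sub_subset_sub_right hV)))⟩
end
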